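/- Let σ > 3. There exists a constant C = C(σ) > 0 such that for every smooth divergence-free zero-mean vector field b = (b¹,b²,b³) on 𝕋³ and every smooth zero-mean ℝ²-valued function V on 𝕋³ with 𝒫V = V, writing B = b·∇ and b^h = (b¹,b²), the Itô–Stratonovich corrector satisfies ⟨(𝒫B)²V, Λ^{2σ}V⟩ + ‖Λ^σ 𝒫BV‖² ≤ C ( ‖b‖_{H^{σ+3}} ‖∂_z b^h‖_{H^{σ−3/2}} ‖V‖²_{H^{σ+1/2}} + ‖b‖²_{H^{σ+3}} ‖V‖_{H^σ} ‖V‖_{H^{σ+1/2}} + ‖b‖²_{H^{σ+3}} ‖V‖²_{H^σ} ). -/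

import Mathlib

/-!
We model functions on the torus `𝕋³ = ℝ³/ℤ³` by their Fourier coefficients,
indexed by `n ∈ ℤ³` (the actual frequency being `k = 2πn ∈ 2πℤ³`).
Smoothness corresponds to rapid decay of the Fourier coefficients, real-valuedness
to the usual conjugation symmetry, products to convolution of coefficients, and
the `L²` norm/inner product are given by Plancherel.
-/

noncomputable section

open scoped BigOperators
open Complex

/-- Fourier frequencies of functions on `𝕋³`, indexed by `n ∈ ℤ³`; the actual
frequency is `k = 2πn ∈ 2πℤ³`. -/
abbrev Z3 : Type := Fin 3 → ℤ

/-- The Euclidean length `|k|` of the frequency `k = 2πn`. -/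
def knorm (n : Z3) : ℝ := 2 * Real.pi * Real.sqrt (∑ i, ((n i : ℝ)) ^ 2)

/-- `Λ^s = (−Δ)^{s/2}` as a Fourier multiplier: `(Λ^s f)^_k = |k|^s f^_k`. -/
def lam (s : ℝ) (c : Z3 → ℂ) : Z3 → ℂ :=
  fun n => Complex.ofReal (knorm n ^ s) * c n

/-- Squared `L²(𝕋³)` norm (Plancherel). -/
def l2sq (c : Z3 → ℂ) : ℝ := ∑' n : Z3, ‖c n‖ ^ 2

/-- `L²(𝕋³)` norm. -/
def l2norm (c : Z3 → ℂ) : ℝ := Real.sqrt (l2sq c)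

/-- `L²(𝕋³)` inner product of two real-valued functions (Plancherel). -/
def inner2 (c d : Z3 → ℂ) : ℝ := (∑' n : Z3, c n * (starRingEnd ℂ) (d n)).re

/-- Sobolev `H^σ` norm: `(∑_k (1+|k|^{2σ})|f^_k|²)^{1/2}`. -/
def hnorm (σ : ℝ) (c : Z3 → ℂ) : ℝ :=
  Real.sqrt (∑' n : Z3, (1 + knorm n ^ (2 * σ)) * ‖c n‖ ^ 2)

/-- The partial derivative `∂_j` as a Fourier multiplier. -/
def pd (j : Fin 3) (c : Z3 → ℂ) : Z3 → ℂ :=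
  fun n => Complex.I * Complex.ofReal (2 * Real.pi * (n j : ℝ)) * c n

/-- Pointwise product of two functions = convolution of Fourier coefficients. -/
def conv (c d : Z3 → ℂ) : Z3 → ℂ := fun n => ∑' m : Z3, c m * d (n - m)

/-- The coefficients of a real-valued function. -/
def IsRealFn (c : Z3 → ℂ) : Prop := ∀ n : Z3, c (-n) = (starRingEnd ℂ) (c n)

/-- Rapid decay of the Fourier coefficients, i.e. smoothness of the function. -/
def RapidDecay (c : Z3 → ℂ) : Prop :=
  ∀ N : ℕ, ∃ C : ℝ, ∀ n : Z3, ‖c n‖ * (1 + knorm n) ^ N ≤ C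

/-- A smooth real-valued function on `𝕋³`, described by its Fourier coefficients. -/
def SmoothFun (c : Z3 → ℂ) : Prop := IsRealFn c ∧ RapidDecay c

/-- Zero mean. -/
def ZeroMean (c : Z3 → ℂ) : Prop := c 0 = 0

/-- A divergence-free vector field `b = (b¹,b²,b³)`: `∀ k, ∑_j k_j b^j_k = 0`. -/
def DivFree (b : Fin 3 → Z3 → ℂ) : Prop :=
  ∀ n : Z3, ∑ j : Fin 3, (n j : ℂ) * b j n = 0

/-- The transport operator `b·∇ = b¹∂_{x₁} + b²∂_{x₂} + b³∂_z`. -/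
def transport (b : Fin 3 → Z3 → ℂ) (c : Z3 → ℂ) : Z3 → ℂ :=
  fun n => ∑ j : Fin 3, conv (b j) (pd j c) n

/-- The commutator `[Λ^s, b·∇]`. -/
def commLam (s : ℝ) (b : Fin 3 → Z3 → ℂ) (c : Z3 → ℂ) : Z3 → ℂ :=
  lam s (transport b c) - transport b (lam s c)

/-- `H^σ` norm of a 3-component vector field. -/
def hnormV3 (σ : ℝ) (b : Fin 3 → Z3 → ℂ) : ℝ :=
  Real.sqrt (∑ j : Fin 3, (hnorm σ (b j)) ^ 2)

/-- `Λ^s` acting componentwise on ℝ²-valued functions. -/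
def lamV (s : ℝ) (V : Fin 2 → Z3 → ℂ) : Fin 2 → Z3 → ℂ := fun i => lam s (V i)

/-- `b·∇` acting componentwise on ℝ²-valued functions. -/
def transportV (b : Fin 3 → Z3 → ℂ) (V : Fin 2 → Z3 → ℂ) : Fin 2 → Z3 → ℂ :=
  fun i => transport b (V i)

/-- `[Λ^s, b·∇]` acting componentwise on ℝ²-valued functions. -/
def commLamV (s : ℝ) (b : Fin 3 → Z3 → ℂ) (V : Fin 2 → Z3 → ℂ) : Fin 2 → Z3 → ℂ :=
  fun i => commLam s b (V i)

/-- `L²` norm of an ℝ²-valued function. -/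
def l2normV (V : Fin 2 → Z3 → ℂ) : ℝ := Real.sqrt (∑ i : Fin 2, l2sq (V i))

/-- `L²` inner product of ℝ²-valued functions. -/
def inner2V (V W : Fin 2 → Z3 → ℂ) : ℝ := ∑ i : Fin 2, inner2 (V i) (W i)

/-- `H^σ` norm of an ℝ²-valued function. -/
def hnormV2 (σ : ℝ) (V : Fin 2 → Z3 → ℂ) : ℝ :=
  Real.sqrt (∑ i : Fin 2, (hnorm σ (V i)) ^ 2)

/-- The hydrostatic Leray projection `𝒫φ = φ − ∇_h Δ_h^{-1} ∇_h · φ̄` as a Fourier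
multiplier: the barotropic part `φ̄` consists of the modes with `n₃ = 0`, on which
`∇_h Δ_h^{-1} ∇_h ·` acts as `φ̂ ↦ n_h (n_h · φ̂)/|n_h|²` (for `n_h ≠ 0`). -/
def hproj (V : Fin 2 → Z3 → ℂ) : Fin 2 → Z3 → ℂ := fun i n =>
  if n 2 = 0 ∧ ¬(n 0 = 0 ∧ n 1 = 0) then
    V i n - (n i.castSucc : ℂ) * ((n 0 : ℂ) * V 0 n + (n 1 : ℂ) * V 1 n) /
      (((n 0 : ℂ)) ^ 2 + ((n 1 : ℂ)) ^ 2)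
  else V i n

/-- `ℚ = I − 𝒫`. -/
def qproj (V : Fin 2 → Z3 → ℂ) : Fin 2 → Z3 → ℂ := fun i => V i - hproj V i

/-- The commutator `[𝒫, b·∇]` on ℝ²-valued functions. -/
def commProj (b : Fin 3 → Z3 → ℂ) (V : Fin 2 → Z3 → ℂ) : Fin 2 → Z3 → ℂ :=
  fun i => hproj (transportV b V) i - transportV b (hproj V) i

/-- A smooth ℝ²-valued function on `𝕋³`. -/
def SmoothV2 (V : Fin 2 → Z3 → ℂ) : Prop := ∀ i, SmoothFun (V i)

/-- A smooth vector field on `𝕋³`. -/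
def SmoothV3 (b : Fin 3 → Z3 → ℂ) : Prop := ∀ j, SmoothFun (b j)

/-- `∂_z b^h = ∂_z (b¹, b²)`. -/
def dzbh (b : Fin 3 → Z3 → ℂ) : Fin 2 → Z3 → ℂ := fun i => pd 2 (b i.castSucc)

/-- `𝒫B V = 𝒫(b·∇V)`. -/
def PB (b : Fin 3 → Z3 → ℂ) (V : Fin 2 → Z3 → ℂ) : Fin 2 → Z3 → ℂ :=
  hproj (transportV b V)

section
open scoped BigOperators
open Complex

abbrev E3 : Type := EuclideanSpace ℝ (Fin 3)

/-- frequency vector `2πn` in Euclidean space -/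
def ev (n : Z3) : E3 := WithLp.toLp 2 (fun i => 2 * Real.pi * (n i : ℝ))

lemma knorm_eq (n : Z3) : knorm n = ‖ev n‖ := by
  unfold knorm ev
  rw [EuclideanSpace.norm_eq]
  simp only [Real.norm_eq_abs, sq_abs, mul_pow]
  rw [← Finset.mul_sum, Real.sqrt_mul (by positivity), ← mul_pow, Real.sqrt_sq (by positivity)]

lemma ev_add (n m : Z3) : ev (n + m) = ev n + ev m := by
  ext i; simp [ev]; ring

lemma ev_sub (n m : Z3) : ev (n - m) = ev n - ev m := by
  ext i; simp [ev]; ring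

lemma knorm_nonneg (n : Z3) : 0 ≤ knorm n := by rw [knorm_eq]; positivity

lemma knorm_zero : knorm 0 = 0 := by simp [knorm]

lemma two_pi_ge_one : (1 : ℝ) ≤ 2 * Real.pi := by linarith [Real.pi_gt_three]

lemma one_le_knorm {n : Z3} (h : n ≠ 0) : 1 ≤ knorm n := by
  obtain ⟨i, hi⟩ := Function.ne_iff.mp h
  have h1 : (1 : ℝ) ≤ (n i : ℝ) ^ 2 := by
    have : 1 ≤ (n i) ^ 2 := by
      have := Int.one_le_abs hi
      nlinarith [sq_abs (n i)]
    exact_mod_cast this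
  have h2 : (1 : ℝ) ≤ ∑ i, ((n i : ℝ)) ^ 2 :=
    h1.trans (Finset.single_le_sum (f := fun i => ((n i : ℝ)) ^ 2) (fun _ _ => by positivity)
      (Finset.mem_univ i))
  have h3 : 1 ≤ Real.sqrt (∑ i, ((n i : ℝ)) ^ 2) := Real.one_le_sqrt.mpr h2
  unfold knorm
  nlinarith [two_pi_ge_one]

lemma knorm_sub_le (n m : Z3) : knorm n ≤ knorm (n - m) + knorm m := by
  simp only [knorm_eq, ev_sub]
  calc ‖ev n‖ = ‖(ev n - ev m) + ev m‖ := by simp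
    _ ≤ _ := norm_add_le _ _

lemma knorm_neg (n : Z3) : knorm (-n) = knorm n := by
  simp [knorm]

lemma knorm_sub_comm (n m : Z3) : knorm (n - m) = knorm (m - n) := by
  rw [← knorm_neg, neg_sub]

lemma summable_knorm {r : ℝ} (hr : 3 < r) : Summable fun n : Z3 => knorm n ^ (-r) := by
  let b := (EuclideanSpace.basisFun (Fin 3) ℝ).toBasis
  let L : Submodule ℤ E3 := Submodule.span ℤ (Set.range b)
  have hfr : Module.finrank ℤ L = 3 := by
    rw [ZLattice.rank ℝ L]; simp
  have hs : Summable fun z : L => ‖z‖ ^ (-r) :=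
    ZLattice.summable_norm_rpow L (-r) (by rw [hfr]; push_cast; linarith)
  let φ : Z3 → L := fun n => ⟨∑ i, n i • b i, Submodule.sum_mem _ fun i _ =>
    Submodule.smul_mem _ _ (Submodule.subset_span ⟨i, rfl⟩)⟩
  have hev : ∀ n, ev n = (2 * Real.pi) • (φ n : E3) := by
    intro n
    ext i
    simp [ev, φ, b, Finset.sum_apply, Pi.single_apply]
  have hinj : Function.Injective φ := by
    intro n m h
    have : ev n = ev m := by rw [hev, hev, h]
    funext i
    have h2 : (ev n) i = (ev m) i := by rw [this]
    simp only [ev] at h2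
    have := mul_left_cancel₀ (by positivity) h2
    exact_mod_cast this
  have := (hs.comp_injective hinj).mul_left ((2 * Real.pi) ^ (-r))
  refine this.congr fun n => ?_
  rw [knorm_eq, hev, norm_smul, Real.norm_of_nonneg (by positivity : 0 ≤ 2 * Real.pi),
    Real.mul_rpow (x := 2 * Real.pi) (by positivity) (by positivity)]
  rfl

lemma rpow_diff {p M s t : ℝ} (hp : 1 ≤ p) (hs : 0 ≤ s) (hsM : s ≤ M) (ht : 0 ≤ t) (htM : t ≤ M) :
    |s ^ p - t ^ p| ≤ p * M ^ (p - 1) * |s - t| := by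
  have := Convex.norm_image_sub_le_of_norm_hasDerivWithin_le (f := fun x : ℝ => x ^ p)
    (f' := fun x => p * x ^ (p - 1)) (s := Set.Icc 0 M) (C := p * M ^ (p - 1))
    (fun x _ => (Real.hasDerivAt_rpow_const (Or.inr hp)).hasDerivWithinAt)
    (fun x hx => by
      rw [Real.norm_of_nonneg (mul_nonneg (by linarith) (Real.rpow_nonneg hx.1 _))]
      have := Real.rpow_le_rpow hx.1 hx.2 (by linarith : 0 ≤ p - 1)
      gcongr) (convex_Icc 0 M) ⟨ht, htM⟩ ⟨hs, hsM⟩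
  simpa [Real.norm_eq_abs] using this

lemma norm_rpow_diff {p M : ℝ} {x y : E3} (hp : 1 ≤ p) (hx : ‖x‖ ≤ M) (hy : ‖y‖ ≤ M) :
    |‖x‖ ^ p - ‖y‖ ^ p| ≤ p * M ^ (p - 1) * ‖x - y‖ := by
  have hM : 0 ≤ M := (norm_nonneg x).trans hx
  refine (rpow_diff hp (norm_nonneg x) hx (norm_nonneg y) hy).trans ?_
  have := abs_norm_sub_norm_le x y
  gcongr

lemma grad_diff {q M : ℝ} {x y : E3} (hq : 1 ≤ q) (hx : ‖x‖ ≤ M) (hy : ‖y‖ ≤ M) :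
    ‖‖x‖ ^ q • x - ‖y‖ ^ q • y‖ ≤ (q + 1) * M ^ q * ‖x - y‖ := by
  have hM : 0 ≤ M := (norm_nonneg x).trans hx
  have e : ‖x‖ ^ q • x - ‖y‖ ^ q • y = (‖x‖ ^ q - ‖y‖ ^ q) • x + ‖y‖ ^ q • (x - y) := by
    rw [sub_smul, smul_sub]; abel
  have h1 := norm_rpow_diff hq hx hy
  have h2 : ‖y‖ ^ q ≤ M ^ q := Real.rpow_le_rpow (norm_nonneg y) hy (by linarith)
  have h3 : M ^ (q - 1) * M = M ^ q := by
    rcases hM.eq_or_lt with h | h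
    · rw [← h, Real.zero_rpow (by linarith : q ≠ 0)]; simp
    · rw [← Real.rpow_add_one h.ne']; ring_nf
  rw [e]
  calc _ ≤ ‖(‖x‖ ^ q - ‖y‖ ^ q) • x‖ + ‖‖y‖ ^ q • (x - y)‖ := norm_add_le _ _
    _ = |‖x‖ ^ q - ‖y‖ ^ q| * ‖x‖ + ‖y‖ ^ q * ‖x - y‖ := by
        rw [norm_smul, norm_smul, Real.norm_eq_abs, Real.norm_of_nonneg (by positivity)]
    _ ≤ (q * M ^ (q - 1) * ‖x - y‖) * M + M ^ q * ‖x - y‖ := by gcongr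
    _ = q * (M ^ (q - 1) * M) * ‖x - y‖ + M ^ q * ‖x - y‖ := by ring
    _ = _ := by rw [h3]; ring

lemma second_diff {p : ℝ} (hp : 3 ≤ p) (l a c : E3) :
    |‖l + a + c‖ ^ p - ‖l + a‖ ^ p - ‖l + c‖ ^ p + ‖l‖ ^ p| ≤
      p * (p - 1) * (‖l‖ + ‖a‖ + ‖c‖) ^ (p - 2) * ‖a‖ * ‖c‖ := by
  set S := ‖l‖ + ‖a‖ + ‖c‖ with hS
  let G : E3 → (E3 →L[ℝ] ℝ) := fun x => (p * ‖x‖ ^ (p - 2)) • innerSL ℝ x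
  have hd : ∀ (u : E3) (t : ℝ), HasDerivAt (fun t : ℝ => ‖u + t • c‖ ^ p) (G (u + t • c) c) t := by
    intro u t
    have h1 : HasDerivAt (fun t : ℝ => u + t • c) c t := by
      simpa using ((hasDerivAt_id t).smul_const c).const_add u
    exact (hasFDerivAt_norm_rpow (u + t • c) (by linarith : 1 < p)).comp_hasDerivAt t h1
  have key := Convex.norm_image_sub_le_of_norm_hasDerivWithin_le
    (f := fun t : ℝ => ‖(l + a) + t • c‖ ^ p - ‖l + t • c‖ ^ p)
    (f' := fun t => G ((l + a) + t • c) c - G (l + t • c) c) (s := Set.Icc (0 : ℝ) 1)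
    (C := p * (p - 1) * S ^ (p - 2) * ‖a‖ * ‖c‖)
    (fun t _ => ((hd (l + a) t).sub (hd l t)).hasDerivWithinAt)
    (fun t ht => by
      have e : G ((l + a) + t • c) c - G (l + t • c) c =
          p * inner ℝ (‖(l + a) + t • c‖ ^ (p - 2) • ((l + a) + t • c)
            - ‖l + t • c‖ ^ (p - 2) • (l + t • c)) c := by
        simp only [G, inner_sub_left, smul_apply, innerSL_apply_apply,
          real_inner_smul_left, smul_eq_mul]
        ring
      have htc : ‖t • c‖ ≤ ‖c‖ := by
        rw [norm_smul, Real.norm_of_nonneg ht.1]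
        exact mul_le_of_le_one_left (norm_nonneg c) ht.2
      have hx : ‖(l + a) + t • c‖ ≤ S := by
        have := norm_add_le (l + a) (t • c)
        have := norm_add_le l a
        linarith
      have hy : ‖l + t • c‖ ≤ S := by
        have := norm_add_le l (t • c)
        have := norm_nonneg a
        linarith
      have hg := grad_diff (by linarith : 1 ≤ p - 2) hx hy
      have e2 : (l + a) + t • c - (l + t • c) = a := by abel
      rw [e2] at hg
      rw [e, norm_mul, Real.norm_of_nonneg (by linarith : 0 ≤ p)]
      calc _ ≤ p * (‖‖(l + a) + t • c‖ ^ (p - 2) • ((l + a) + t • c)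
            - ‖l + t • c‖ ^ (p - 2) • (l + t • c)‖ * ‖c‖) := by
              have := norm_inner_le_norm (𝕜 := ℝ) (‖(l + a) + t • c‖ ^ (p - 2) • ((l + a) + t • c)
                - ‖l + t • c‖ ^ (p - 2) • (l + t • c)) c
              gcongr
        _ ≤ p * (((p - 2 + 1) * S ^ (p - 2) * ‖a‖) * ‖c‖) := by gcongr
        _ = _ := by ring)
    (convex_Icc 0 1) (Set.left_mem_Icc.mpr zero_le_one) (Set.right_mem_Icc.mpr zero_le_one)
  simp only [one_smul, zero_smul, add_zero, sub_zero, norm_one, mul_one, Real.norm_eq_abs] at key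
  refine le_trans (le_of_eq ?_) key
  congr 1; ring
end

section
open scoped BigOperators
open Complex

lemma le_mul3 {x y z : ℝ} (hx : 1 ≤ x) (hy : 1 ≤ y) (hz : 1 ≤ z) : x + y + z ≤ 3 * (x * y * z) := by
  have hxy : 1 ≤ x * y := one_le_mul_of_one_le_of_one_le hx hy
  have h1 : x ≤ x * y * z := by nlinarith
  have h2 : y ≤ x * y * z := by nlinarith
  have h3 : z ≤ x * y * z := by nlinarith
  linarith

/-- quadrilateral inequality: `S² ≤ 27 a c d e` -/
lemma quad_S {a c d e : ℝ} (ha : 1 ≤ a) (hc : 1 ≤ c) (hd : 1 ≤ d) (he : 1 ≤ e)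
    (h1 : a ≤ c + d + e) (h2 : c ≤ a + d + e) (h3 : d ≤ a + c + e) :
    (a + c + d) ^ 2 ≤ 27 * (a * (c * d * e)) := by
  have k1 := le_mul3 hc hd he
  have k2 := le_mul3 ha hd he
  have k3 := le_mul3 ha hc he
  have key : ∀ x y : ℝ, 0 ≤ x → a + c + d ≤ 3 * x → x ≤ 3 * y → (a + c + d) ^ 2 ≤ 27 * (x * y) := by
    intro x y hx hS hy
    calc (a + c + d) ^ 2 ≤ (3 * x) ^ 2 := by gcongr
      _ = 9 * x * x := by ring
      _ ≤ 9 * x * (3 * y) := by gcongr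
      _ = _ := by ring
  rcases le_total a c with hac | hac <;> rcases le_total c d with hcd | hcd <;>
    rcases le_total a d with had | had
  all_goals first
    | (have := key a (c * d * e) (by linarith) (by linarith) (by linarith); linarith)
    | (have := key c (a * d * e) (by linarith) (by linarith) (by linarith); linarith)
    | (have := key d (a * c * e) (by linarith) (by linarith) (by linarith); linarith)

lemma pw1 {σ a c d e : ℝ} (hσ : 3 < σ) (ha : 1 ≤ a) (hc : 1 ≤ c) (hd : 1 ≤ d) (he : 1 ≤ e)
    (h1 : a ≤ c + d + e) (h2 : c ≤ a + d + e) (h3 : d ≤ a + c + e) :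
    c * d * a ^ 2 * (a + c + d) ^ (2 * σ - 2) ≤
      27 ^ σ * (e ^ σ * a ^ σ * c ^ (σ + 1) * d ^ (σ + 1)) := by
  have hS := quad_S ha hc hd he h1 h2 h3
  have a0 : 0 < a := by linarith
  have c0 : 0 < c := by linarith
  have d0 : 0 < d := by linarith
  have e0 : 0 < e := by linarith
  have S5 : (a + c + d) ≤ 5 * (c * d * e) := by
    have k1 := le_mul3 hc hd he
    have : c ≤ c * d * e := by nlinarith [one_le_mul_of_one_le_of_one_le hd he]
    have : d ≤ c * d * e := by nlinarith [one_le_mul_of_one_le_of_one_le hc he]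
    linarith
  have S2 : (a + c + d) ^ 2 ≤ 27 ^ 2 * (c * d * e) ^ 2 := by
    calc _ ≤ (5 * (c * d * e)) ^ 2 := by gcongr
      _ ≤ _ := by rw [mul_pow]; gcongr; norm_num
  have S0 : 0 < a + c + d := by positivity
  have e1 : (a + c + d) ^ (2 * σ - 2) = ((a + c + d) ^ 2) ^ (σ - 2) * (a + c + d) ^ 2 := by
    rw [← Real.rpow_natCast, ← Real.rpow_mul S0.le, ← Real.rpow_add S0]
    congr 1; push_cast; ring
  have e2 : ((a + c + d) ^ 2) ^ (σ - 2) ≤ (27 * (a * (c * d * e))) ^ (σ - 2) :=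
    Real.rpow_le_rpow (by positivity) hS (by linarith)
  have spl : ∀ x : ℝ, 0 < x → x ^ (σ - 2) * x ^ 2 = x ^ σ := by
    intro x hx
    rw [← Real.rpow_natCast, ← Real.rpow_add hx]; congr 1; push_cast; ring
  rw [e1]
  calc c * d * a ^ 2 * (((a + c + d) ^ 2) ^ (σ - 2) * (a + c + d) ^ 2)
      ≤ c * d * a ^ 2 * ((27 * (a * (c * d * e))) ^ (σ - 2) * (27 ^ 2 * (c * d * e) ^ 2)) := by
        gcongr
    _ = (27 ^ (σ - 2) * 27 ^ 2) * ((e ^ (σ - 2) * e ^ 2) * (a ^ (σ - 2) * a ^ 2)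
        * ((c ^ (σ - 2) * c ^ 2) * c) * ((d ^ (σ - 2) * d ^ 2) * d)) := by
        rw [Real.mul_rpow (by norm_num) (by positivity), Real.mul_rpow a0.le (by positivity),
          Real.mul_rpow (by positivity) e0.le, Real.mul_rpow c0.le d0.le]
        ring
    _ = _ := by
        rw [spl 27 (by norm_num), spl e e0, spl a a0, spl c c0, spl d d0,
          Real.rpow_add_one c0.ne', Real.rpow_add_one d0.ne']

lemma pw2 {σ a c d e μ : ℝ} (hσ : 3 < σ) (ha : 1 ≤ a) (hc : 1 ≤ c) (hd : 1 ≤ d) (he : 1 ≤ e)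
    (h1 : a ≤ c + d + e) (h2 : c ≤ a + d + e) (h3 : d ≤ a + c + e)
    (hμ0 : 0 ≤ μ) (hμ1 : μ ≤ a) (hμ2 : μ ≤ e + c) :
    d * μ * (c + d) * (a + c + d) ^ (2 * σ - 1) ≤
      27 ^ σ * 20 * (e ^ σ * a ^ σ * c ^ (σ + 1) * d ^ (σ + 1)) := by
  have hS := quad_S ha hc hd he h1 h2 h3
  have a0 : 0 < a := by linarith
  have c0 : 0 < c := by linarith
  have d0 : 0 < d := by linarith
  have e0 : 0 < e := by linarith
  have S0 : 0 < a + c + d := by positivity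
  have hec : e + c ≤ 2 * (e * c) := by nlinarith
  have hcd : c + d ≤ 2 * (c * d) := by nlinarith
  have hmS : μ * (a + c + d) ≤ 10 * (a * e * c) := by
    have hcc : c ≤ e * c := by nlinarith
    have hee : e ≤ e * c := by nlinarith
    rcases le_total a (e * c) with h | h
    · calc μ * (a + c + d) ≤ a * (5 * (e * c)) := by
            apply mul_le_mul hμ1 (by linarith) S0.le a0.le
        _ ≤ _ := by nlinarith [mul_pos (mul_pos a0 e0) c0]
    · calc μ * (a + c + d) ≤ (2 * (e * c)) * (5 * a) := by
            apply mul_le_mul (by linarith) (by linarith) S0.le (by positivity)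
        _ = _ := by ring
  have e1 : (a + c + d) ^ (2 * σ - 1) = ((a + c + d) ^ 2) ^ (σ - 1) * (a + c + d) := by
    rw [← Real.rpow_natCast, ← Real.rpow_mul S0.le, ← Real.rpow_add_one S0.ne']
    congr 1; push_cast; ring
  have e2 : ((a + c + d) ^ 2) ^ (σ - 1) ≤ (27 * (a * (c * d * e))) ^ (σ - 1) :=
    Real.rpow_le_rpow (by positivity) hS (by linarith)
  have spl : ∀ x : ℝ, 0 < x → x ^ σ = x ^ (σ - 1) * x := by
    intro x hx
    rw [← Real.rpow_add_one hx.ne']; congr 1; ring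
  have h27 : (27 : ℝ) ^ (σ - 1) ≤ 27 ^ σ :=
    Real.rpow_le_rpow_of_exponent_le (by norm_num) (by linarith)
  rw [e1]
  calc d * μ * (c + d) * (((a + c + d) ^ 2) ^ (σ - 1) * (a + c + d))
      = d * (c + d) * (((a + c + d) ^ 2) ^ (σ - 1) * (μ * (a + c + d))) := by ring
    _ ≤ d * (2 * (c * d)) * ((27 * (a * (c * d * e))) ^ (σ - 1) * (10 * (a * e * c))) := by
        gcongr
    _ = 27 ^ (σ - 1) * 20 * ((e ^ (σ - 1) * e) * (a ^ (σ - 1) * a)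
        * ((c ^ (σ - 1) * c) * c) * ((d ^ (σ - 1) * d) * d)) := by
        rw [Real.mul_rpow (by norm_num) (by positivity), Real.mul_rpow a0.le (by positivity),
          Real.mul_rpow (by positivity) e0.le, Real.mul_rpow c0.le d0.le]
        ring
    _ ≤ 27 ^ σ * 20 * ((e ^ (σ - 1) * e) * (a ^ (σ - 1) * a)
        * ((c ^ (σ - 1) * c) * c) * ((d ^ (σ - 1) * d) * d)) := by gcongr
    _ = _ := by
        rw [← spl e e0, ← spl a a0, ← spl c c0, ← spl d d0,
          Real.rpow_add_one c0.ne', Real.rpow_add_one d0.ne']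

lemma pw3_aux {σ x y c : ℝ} (hσ : 3 < σ) (hx : 1 ≤ x) (hc : 1 ≤ c)
    (h1 : y ≤ x + c) (hxy : x ≤ y) :
    c * x * (x + y) ^ (2 * σ - 1) ≤ 4 ^ (2 * σ) * (x ^ σ * y ^ σ * c ^ σ) := by
  have x0 : 0 < x := by linarith
  have y0 : 0 < y := by linarith
  have c0 : 0 < c := by linarith
  have h2 : x + y ≤ 4 * y := by linarith
  have h3 : x + y ≤ 4 * (c * x) := by nlinarith
  have S0 : 0 < x + y := by positivity
  have spl : ∀ x : ℝ, 0 < x → x ^ σ = x ^ (σ - 1) * x := by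
    intro x hx
    rw [← Real.rpow_add_one hx.ne']; congr 1; ring
  have e1 : (x + y) ^ (2 * σ - 1) = (x + y) ^ σ * (x + y) ^ (σ - 1) := by
    rw [← Real.rpow_add S0]; congr 1; ring
  have e2 : (x + y) ^ σ ≤ (4 * y) ^ σ := Real.rpow_le_rpow S0.le h2 (by linarith)
  have e3 : (x + y) ^ (σ - 1) ≤ (4 * (c * x)) ^ (σ - 1) := Real.rpow_le_rpow S0.le h3 (by linarith)
  have e4 : (4 : ℝ) ^ σ * 4 ^ (σ - 1) ≤ 4 ^ (2 * σ) := by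
    rw [← Real.rpow_add (by norm_num)]
    exact Real.rpow_le_rpow_of_exponent_le (by norm_num) (by linarith)
  rw [e1]
  calc c * x * ((x + y) ^ σ * (x + y) ^ (σ - 1))
      ≤ c * x * ((4 * y) ^ σ * (4 * (c * x)) ^ (σ - 1)) := by gcongr
    _ = (4 ^ σ * 4 ^ (σ - 1)) * (x ^ σ * y ^ σ * c ^ σ) := by
        rw [Real.mul_rpow (by norm_num) y0.le, Real.mul_rpow (by norm_num) (by positivity),
          Real.mul_rpow c0.le x0.le, spl x x0, spl c c0]
        ring
    _ ≤ _ := by gcongr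

lemma pw3 {σ x y c μ : ℝ} (hσ : 3 < σ) (hx : 1 ≤ x) (hy : 1 ≤ y) (hc : 1 ≤ c)
    (h1 : y ≤ x + c) (h2 : x ≤ y + c) (hμ0 : 0 ≤ μ) (hμx : μ ≤ x) (hμy : μ ≤ y) :
    c * μ * (x + y) ^ (2 * σ - 1) ≤ 4 ^ (2 * σ) * (x ^ σ * y ^ σ * c ^ σ) := by
  have : 0 ≤ (x + y) ^ (2 * σ - 1) := by positivity
  rcases le_total x y with h | h
  · exact le_trans (by gcongr) (pw3_aux hσ hx hc h1 h)
  · have := pw3_aux hσ hy hc h2 h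
    rw [add_comm x y]
    refine le_trans ?_ (this.trans (le_of_eq (by ring)))
    gcongr

lemma rpow_add_le' {s x y : ℝ} (hs : 0 ≤ s) (hx : 0 ≤ x) (hy : 0 ≤ y) :
    (x + y) ^ s ≤ 2 ^ s * (x ^ s + y ^ s) := by
  rcases le_total x y with h | h
  · calc (x + y) ^ s ≤ (2 * y) ^ s := Real.rpow_le_rpow (by positivity) (by linarith) hs
      _ = 2 ^ s * y ^ s := Real.mul_rpow (by norm_num) hy
      _ ≤ _ := by have := Real.rpow_nonneg hx s; gcongr; linarith
  · calc (x + y) ^ s ≤ (2 * x) ^ s := Real.rpow_le_rpow (by positivity) (by linarith) hs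
      _ = 2 ^ s * x ^ s := Real.mul_rpow (by norm_num) hx
      _ ≤ _ := by have := Real.rpow_nonneg hy s; gcongr; linarith

lemma rpow_le_mul {s x y z : ℝ} (hs : 0 ≤ s) (hx : 1 ≤ x) (hy : 1 ≤ y) (hz : 0 ≤ z)
    (h : z ≤ x + y) : z ^ s ≤ 2 ^ s * (x ^ s * y ^ s) := by
  have x0 : 0 < x := by linarith
  have y0 : 0 < y := by linarith
  calc z ^ s ≤ (2 * (x * y)) ^ s := Real.rpow_le_rpow hz (by nlinarith) hs
    _ = _ := by rw [Real.mul_rpow (by norm_num) (by positivity), Real.mul_rpow x0.le y0.le]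
end

section
open scoped BigOperators ENNReal
open Complex

/-! ### ENNReal sums -/

lemma ennreal_two_mul_le (x y : ℝ≥0∞) : 2 * (x * y) ≤ x ^ 2 + y ^ 2 := by
  by_cases hx : x = ⊤
  · simp [hx]
  by_cases hy : y = ⊤
  · simp [hy]
  lift x to NNReal using hx
  lift y to NNReal using hy
  norm_cast
  have := two_mul_le_add_sq x y
  rwa [mul_assoc] at this

lemma tsum_mul_tsum' {ι κ : Type*} (f : ι → ℝ≥0∞) (g : κ → ℝ≥0∞) :
    (∑' i, f i) * (∑' j, g j) = ∑' i, ∑' j, f i * g j := by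
  simp_rw [ENNReal.tsum_mul_left, ENNReal.tsum_mul_right]

lemma cs2 {ι : Type*} (u v : ι → ℝ≥0∞) :
    (∑' i, u i * v i) ^ 2 ≤ (∑' i, u i ^ 2) * (∑' i, v i ^ 2) := by
  have h : 2 * (∑' i, u i * v i) ^ 2 ≤ 2 * ((∑' i, u i ^ 2) * (∑' i, v i ^ 2)) := by
    calc 2 * (∑' i, u i * v i) ^ 2 = ∑' i, ∑' j, 2 * ((u i * v j) * (u j * v i)) := by
          rw [sq, tsum_mul_tsum', ← ENNReal.tsum_mul_left]
          refine tsum_congr fun i => ?_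
          rw [← ENNReal.tsum_mul_left]
          refine tsum_congr fun j => ?_
          ring
      _ ≤ ∑' i, ∑' j, ((u i * v j) ^ 2 + (u j * v i) ^ 2) :=
          ENNReal.tsum_le_tsum fun i => ENNReal.tsum_le_tsum fun j => ennreal_two_mul_le _ _
      _ = (∑' i, ∑' j, u i ^ 2 * v j ^ 2) + ∑' i, ∑' j, v i ^ 2 * u j ^ 2 := by
          rw [← ENNReal.tsum_add]
          refine tsum_congr fun i => ?_
          rw [← ENNReal.tsum_add]
          refine tsum_congr fun j => ?_
          ring
      _ = _ := by
          rw [← tsum_mul_tsum', ← tsum_mul_tsum', two_mul]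
          congr 1
          rw [mul_comm]
  exact (ENNReal.mul_le_mul_iff_right (by simp) (by simp)).mp h

lemma cs1 {ι : Type*} (β w : ι → ℝ≥0∞) :
    (∑' i, β i * w i) ^ 2 ≤ (∑' i, β i) * (∑' i, β i * w i ^ 2) := by
  have h : 2 * (∑' i, β i * w i) ^ 2 ≤ 2 * ((∑' i, β i) * (∑' i, β i * w i ^ 2)) := by
    calc 2 * (∑' i, β i * w i) ^ 2 = ∑' i, ∑' j, β i * β j * (2 * (w i * w j)) := by
          rw [sq, tsum_mul_tsum', ← ENNReal.tsum_mul_left]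
          refine tsum_congr fun i => ?_
          rw [← ENNReal.tsum_mul_left]
          refine tsum_congr fun j => ?_
          ring
      _ ≤ ∑' i, ∑' j, β i * β j * (w i ^ 2 + w j ^ 2) :=
          ENNReal.tsum_le_tsum fun i => ENNReal.tsum_le_tsum fun j => by
            gcongr; exact ennreal_two_mul_le _ _
      _ = (∑' i, ∑' j, β i * (β j * w j ^ 2)) + ∑' i, ∑' j, (β i * w i ^ 2) * β j := by
          rw [← ENNReal.tsum_add]
          refine tsum_congr fun i => ?_
          rw [← ENNReal.tsum_add]
          refine tsum_congr fun j => ?_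
          ring
      _ = _ := by
          rw [← tsum_mul_tsum', ← tsum_mul_tsum', two_mul]
          congr 1
          rw [mul_comm]
  exact (ENNReal.mul_le_mul_iff_right (by simp) (by simp)).mp h

/-- discrete convolution -/
def cv (F G : Z3 → ℝ≥0∞) (n : Z3) : ℝ≥0∞ := ∑' l, F (n - l) * G l

/-- ℓ¹ norm -/
def N1 (F : Z3 → ℝ≥0∞) : ℝ≥0∞ := ∑' n, F n
/-- ℓ² norm -/
def N2 (F : Z3 → ℝ≥0∞) : ℝ≥0∞ := (∑' n, F n ^ 2) ^ (1 / 2 : ℝ)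

lemma tsum_sub_right (F : Z3 → ℝ≥0∞) (l : Z3) : ∑' n, F (n - l) = ∑' n, F n :=
  (Equiv.subRight l).tsum_eq F

lemma tsum_sub_left (F : Z3 → ℝ≥0∞) (n : Z3) : ∑' l, F (n - l) = ∑' l, F l :=
  (Equiv.subLeft n).tsum_eq F

lemma tsum_cv (F G : Z3 → ℝ≥0∞) : ∑' n, cv F G n = N1 F * N1 G := by
  unfold cv N1
  rw [ENNReal.tsum_comm]
  simp_rw [ENNReal.tsum_mul_right, tsum_sub_right, ENNReal.tsum_mul_left]

lemma sqrt_sq' (x : ℝ≥0∞) : (x ^ 2) ^ (1 / 2 : ℝ) = x := by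
  rw [← ENNReal.rpow_natCast, ← ENNReal.rpow_mul]; norm_num

lemma sq_sqrt' (x : ℝ≥0∞) : (x ^ (1 / 2 : ℝ)) ^ 2 = x := by
  rw [← ENNReal.rpow_natCast, ← ENNReal.rpow_mul]; norm_num

lemma le_of_sq_le' {x y : ℝ≥0∞} (h : x ^ 2 ≤ y ^ 2) : x ≤ y := by
  have := ENNReal.rpow_le_rpow h (by norm_num : (0 : ℝ) ≤ 1 / 2)
  rwa [sqrt_sq', sqrt_sq'] at this

lemma N2_sq (F : Z3 → ℝ≥0∞) : N2 F ^ 2 = ∑' n, F n ^ 2 := sq_sqrt' _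

lemma holder (u v : Z3 → ℝ≥0∞) : ∑' n, u n * v n ≤ N2 u * N2 v := by
  apply le_of_sq_le'
  rw [mul_pow, N2_sq, N2_sq]
  exact cs2 u v

lemma young (β w : Z3 → ℝ≥0∞) : N2 (cv β w) ≤ N1 β * N2 w := by
  apply le_of_sq_le'
  rw [mul_pow, N2_sq, N2_sq]
  calc ∑' n, cv β w n ^ 2 ≤ ∑' n, N1 β * cv β (fun l => w l ^ 2) n := by
        refine ENNReal.tsum_le_tsum fun n => ?_
        unfold cv N1
        rw [← tsum_sub_left β n]
        exact cs1 (fun l => β (n - l)) w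
    _ = _ := by
        rw [ENNReal.tsum_mul_left, tsum_cv, sq, mul_assoc]; rfl

lemma cvcv (β w β' w' : Z3 → ℝ≥0∞) :
    ∑' n, cv β w n * cv β' w' n ≤ (N1 β * N2 w) * (N1 β' * N2 w') :=
  (holder _ _).trans (mul_le_mul' (young _ _) (young _ _))

lemma N1_mono {F G : Z3 → ℝ≥0∞} (h : ∀ n, F n ≤ G n) : N1 F ≤ N1 G := ENNReal.tsum_le_tsum h

lemma cv_mono {F G F' G' : Z3 → ℝ≥0∞} (h : ∀ n, F n ≤ F' n) (h' : ∀ n, G n ≤ G' n) (n : Z3) :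
    cv F G n ≤ cv F' G' n := ENNReal.tsum_le_tsum fun _ => mul_le_mul' (h _) (h' _)

/-! ### weighted ℓ¹ -/

def jw (n : Z3) : ℝ≥0∞ := ENNReal.ofReal (1 + knorm n)

lemma one_le_jw (n : Z3) : 1 ≤ jw n := by
  unfold jw
  rw [← ENNReal.ofReal_one]
  exact ENNReal.ofReal_le_ofReal (by linarith [knorm_nonneg n])

lemma jw_mul (n l : Z3) : jw n ≤ jw (n - l) * jw l := by
  unfold jw
  rw [← ENNReal.ofReal_mul (by linarith [knorm_nonneg (n - l)])]
  apply ENNReal.ofReal_le_ofReal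
  nlinarith [knorm_nonneg (n - l), knorm_nonneg l, knorm_sub_le n l,
    mul_nonneg (knorm_nonneg (n - l)) (knorm_nonneg l)]

def L1W (c : Z3 → ℂ) : Prop := ∀ N : ℕ, ∑' n, ‖c n‖ₑ * jw n ^ N ≠ ⊤

lemma RapidDecay.l1w {c : Z3 → ℂ} (h : RapidDecay c) : L1W c := by
  intro N
  obtain ⟨C, hC⟩ := h (N + 4)
  have hs : Summable fun n : Z3 => C * (knorm n ^ (-4 : ℝ) + if n = 0 then 1 else 0) := by
    apply Summable.mul_left
    exact (summable_knorm (by norm_num : (3 : ℝ) < 4)).add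
      (summable_of_ne_finset_zero (s := {0}) (by intro n hn; simp at hn; simp [hn]))
  have hs2 : Summable fun n : Z3 => ‖‖c n‖ * (1 + knorm n) ^ N‖ := by
    refine Summable.of_nonneg_of_le (fun _ => norm_nonneg _) (fun n => ?_) hs
    have k0 := knorm_nonneg n
    rw [Real.norm_of_nonneg (by positivity)]
    have h1 := hC n
    have hC0 : 0 ≤ C := le_trans (by rw [knorm_zero]; positivity) (hC 0)
    have h2 : ‖c n‖ * (1 + knorm n) ^ N ≤ C * ((1 + knorm n) ^ 4)⁻¹ := by
      rw [← div_eq_mul_inv, le_div_iff₀ (by positivity)]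
      calc _ = ‖c n‖ * (1 + knorm n) ^ (N + 4) := by ring
        _ ≤ C := h1
    refine h2.trans ?_
    gcongr
    by_cases hn : n = 0
    · simp [hn, knorm_zero]
    · have := one_le_knorm hn
      rw [Real.rpow_neg k0]
      simp only [hn, if_false, add_zero]
      rw [show (4 : ℝ) = ((4 : ℕ) : ℝ) by norm_num, Real.rpow_natCast]
      gcongr
      linarith
  have := tsum_enorm_ne_top_iff_summable_norm.mpr hs2
  convert this using 3 with n
  have k0 := knorm_nonneg n
  rw [enorm_mul, enorm_norm, enorm_pow, jw, Real.enorm_of_nonneg (by positivity)]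

lemma L1W.mono {c : Z3 → ℂ} {F : Z3 → ℝ≥0∞} (hF : ∀ N : ℕ, ∑' n, F n * jw n ^ N ≠ ⊤)
    (h : ∀ n, ‖c n‖ₑ ≤ F n) : L1W c := fun N =>
  ne_top_of_le_ne_top (hF N) (ENNReal.tsum_le_tsum fun n => by gcongr; exact h n)

lemma L1W.add {c d : Z3 → ℂ} (hc : L1W c) (hd : L1W d) : L1W (fun n => c n + d n) := by
  refine L1W.mono (F := fun n => ‖c n‖ₑ + ‖d n‖ₑ) (fun N => ?_) (fun n => enorm_add_le _ _)
  simp_rw [add_mul]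
  rw [ENNReal.tsum_add]
  exact ENNReal.add_ne_top.mpr ⟨hc N, hd N⟩

lemma L1W.sub {c d : Z3 → ℂ} (hc : L1W c) (hd : L1W d) : L1W (fun n => c n - d n) := by
  refine L1W.mono (F := fun n => ‖c n‖ₑ + ‖d n‖ₑ) (fun N => ?_) (fun n => enorm_sub_le)
  simp_rw [add_mul]
  rw [ENNReal.tsum_add]
  exact ENNReal.add_ne_top.mpr ⟨hc N, hd N⟩

lemma L1W.tsum_ne_top {c : Z3 → ℂ} (hc : L1W c) : ∑' n, ‖c n‖ₑ ≠ ⊤ := by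
  simpa using hc 0

lemma summable_of_enorm {ι : Type*} {f : ι → ℂ} (h : ∑' i, ‖f i‖ₑ ≠ ⊤) : Summable f :=
  (tsum_enorm_ne_top_iff_summable_norm.mp h).of_norm

lemma knorm_rpow_le_jw {s : ℝ} (hs : 0 ≤ s) (n : Z3) :
    ENNReal.ofReal (knorm n ^ s) ≤ jw n ^ (⌈s⌉₊) := by
  unfold jw
  have k0 := knorm_nonneg n
  rw [← ENNReal.ofReal_pow (by linarith)]
  apply ENNReal.ofReal_le_ofReal
  calc knorm n ^ s ≤ (1 + knorm n) ^ s := Real.rpow_le_rpow k0 (by linarith) hs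
    _ ≤ (1 + knorm n) ^ (⌈s⌉₊ : ℝ) :=
        Real.rpow_le_rpow_of_exponent_le (by linarith) (Nat.le_ceil s)
    _ = _ := Real.rpow_natCast _ _

lemma enorm_lam_le {s : ℝ} (hs : 0 ≤ s) (c : Z3 → ℂ) (n : Z3) :
    ‖lam s c n‖ₑ ≤ ‖c n‖ₑ * jw n ^ (⌈s⌉₊) := by
  unfold lam
  rw [enorm_mul, mul_comm]
  gcongr
  refine le_trans (le_of_eq ?_) (knorm_rpow_le_jw hs n)
  rw [← ofReal_norm, Complex.norm_real, Real.norm_of_nonneg (Real.rpow_nonneg (knorm_nonneg n) _)]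

lemma L1W.lam {s : ℝ} (hs : 0 ≤ s) {c : Z3 → ℂ} (hc : L1W c) : L1W (lam s c) := by
  refine L1W.mono (fun N => ?_) (enorm_lam_le hs c)
  have := hc (⌈s⌉₊ + N)
  simpa only [pow_add, mul_assoc] using this

lemma L1W.mul_summable {f g : Z3 → ℂ} (hf : L1W f) (hg : L1W g) :
    Summable fun n => f n * (starRingEnd ℂ) (g n) := by
  apply summable_of_enorm
  refine ne_top_of_le_ne_top (ENNReal.mul_ne_top hf.tsum_ne_top hg.tsum_ne_top) ?_
  rw [tsum_mul_tsum']
  refine ENNReal.tsum_le_tsum fun n => ?_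
  rw [enorm_mul, RCLike.enorm_conj]
  exact ENNReal.le_tsum (f := fun j => ‖f n‖ₑ * ‖g j‖ₑ) n
end

section
open scoped BigOperators ENNReal
open Complex

def dotb (b : Fin 3 → Z3 → ℂ) (m x : Z3) : ℂ :=
  ∑ j, b j m * Complex.ofReal (2 * Real.pi * (x j : ℝ))

def kap (b : Fin 3 → Z3 → ℂ) (n l : Z3) : ℂ := Complex.I * dotb b (n - l) l

def bm (b : Fin 3 → Z3 → ℂ) (m : Z3) : ℝ := ∑ j, ‖b j m‖

lemma bm_nonneg (b : Fin 3 → Z3 → ℂ) (m : Z3) : 0 ≤ bm b m :=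
  Finset.sum_nonneg fun _ _ => norm_nonneg _

lemma dotb_add (b : Fin 3 → Z3 → ℂ) (m x y : Z3) : dotb b m (x + y) = dotb b m x + dotb b m y := by
  unfold dotb
  rw [← Finset.sum_add_distrib]
  refine Finset.sum_congr rfl fun j _ => ?_
  simp only [Pi.add_apply]; push_cast; ring

lemma dotb_self {b : Fin 3 → Z3 → ℂ} (hb : DivFree b) (m : Z3) : dotb b m m = 0 := by
  have := hb m
  unfold dotb
  calc _ = (2 * Real.pi : ℂ) * ∑ j : Fin 3, (m j : ℂ) * b j m := by
        rw [Finset.mul_sum]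
        refine Finset.sum_congr rfl fun j _ => ?_
        push_cast; ring
    _ = 0 := by rw [this, mul_zero]

lemma abs_comp_le (x : Z3) (j : Fin 3) : |2 * Real.pi * (x j : ℝ)| ≤ knorm x := by
  rw [knorm_eq]
  have := EuclideanSpace.norm_eq (ev x)
  have h := PiLp.norm_apply_le (ev x) j
  simpa [ev, Real.norm_eq_abs] using h

lemma norm_dotb_le (b : Fin 3 → Z3 → ℂ) (m x : Z3) : ‖dotb b m x‖ ≤ bm b m * knorm x := by
  unfold dotb bm
  rw [Finset.sum_mul]
  refine (norm_sum_le _ _).trans (Finset.sum_le_sum fun j _ => ?_)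
  rw [norm_mul, Complex.norm_real, Real.norm_eq_abs]
  have := abs_comp_le x j
  gcongr

lemma dotb_eq {b : Fin 3 → Z3 → ℂ} (hb : DivFree b) (n l : Z3) :
    dotb b (n - l) l = dotb b (n - l) n := by
  have h := dotb_add b (n - l) (n - l) l
  rw [dotb_self hb, zero_add, sub_add_cancel] at h
  exact h.symm

lemma norm_kap_le (b : Fin 3 → Z3 → ℂ) (n l : Z3) : ‖kap b n l‖ ≤ bm b (n - l) * knorm l := by
  unfold kap
  rw [norm_mul, Complex.norm_I, one_mul]
  exact norm_dotb_le _ _ _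

lemma norm_kap_le' {b : Fin 3 → Z3 → ℂ} (hb : DivFree b) (n l : Z3) :
    ‖kap b n l‖ ≤ bm b (n - l) * knorm n := by
  unfold kap
  rw [norm_mul, Complex.norm_I, one_mul, dotb_eq hb]
  exact norm_dotb_le _ _ _

lemma kap_anti {b : Fin 3 → Z3 → ℂ} (hb : DivFree b) (hs : SmoothV3 b) (n l : Z3) :
    (starRingEnd ℂ) (kap b n l) = - kap b l n := by
  unfold kap
  rw [dotb_eq hb n l, map_mul, Complex.conj_I]
  have : (starRingEnd ℂ) (dotb b (n - l) n) = dotb b (l - n) n := by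
    unfold dotb
    rw [map_sum]
    refine Finset.sum_congr rfl fun j _ => ?_
    rw [map_mul, Complex.conj_ofReal, ← (hs j).1 (n - l), neg_sub]
  rw [this]; ring

def bmE (b : Fin 3 → Z3 → ℂ) (m : Z3) : ℝ≥0∞ := ENNReal.ofReal (bm b m)

lemma enorm_kap_le (b : Fin 3 → Z3 → ℂ) (n l : Z3) : ‖kap b n l‖ₑ ≤ bmE b (n - l) * jw l := by
  unfold bmE jw
  rw [← ofReal_norm, ← ENNReal.ofReal_mul (bm_nonneg _ _)]
  apply ENNReal.ofReal_le_ofReal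
  refine (norm_kap_le b n l).trans ?_
  have := bm_nonneg b (n - l)
  gcongr
  linarith

lemma bmE_eq (b : Fin 3 → Z3 → ℂ) (m : Z3) : bmE b m = ∑ j, ‖b j m‖ₑ := by
  unfold bmE bm
  rw [ENNReal.ofReal_sum_of_nonneg fun _ _ => norm_nonneg _]
  simp_rw [ofReal_norm]

lemma bmE_sum {b : Fin 3 → Z3 → ℂ} (hs : SmoothV3 b) (N : ℕ) : ∑' m, bmE b m * jw m ^ N ≠ ⊤ := by
  simp_rw [bmE_eq, Finset.sum_mul]
  rw [Summable.tsum_finsetSum fun _ _ => ENNReal.summable]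
  exact ENNReal.sum_ne_top.mpr fun j _ => (hs j).2.l1w N

lemma kap_sum {b : Fin 3 → Z3 → ℂ} (hs : SmoothV3 b) {f : Z3 → ℂ} (hf : L1W f) (N : ℕ) :
    ∑' n, (∑' l, ‖kap b n l‖ₑ * ‖f l‖ₑ) * jw n ^ N ≠ ⊤ := by
  have hle : ∀ n, (∑' l, ‖kap b n l‖ₑ * ‖f l‖ₑ) * jw n ^ N ≤
      cv (fun m => bmE b m * jw m ^ N) (fun l => ‖f l‖ₑ * jw l ^ (N + 1)) n := by
    intro n
    unfold cv
    rw [← ENNReal.tsum_mul_right]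
    refine ENNReal.tsum_le_tsum fun l => ?_
    calc ‖kap b n l‖ₑ * ‖f l‖ₑ * jw n ^ N
        ≤ (bmE b (n - l) * jw l) * ‖f l‖ₑ * (jw (n - l) * jw l) ^ N := by
          gcongr
          · exact enorm_kap_le b n l
          · exact jw_mul n l
      _ = _ := by ring
  refine ne_top_of_le_ne_top ?_ (ENNReal.tsum_le_tsum hle)
  rw [tsum_cv]
  exact ENNReal.mul_ne_top (bmE_sum hs N) (hf (N + 1))

lemma kap_sum0 {b : Fin 3 → Z3 → ℂ} (hs : SmoothV3 b) {f : Z3 → ℂ} (hf : L1W f) :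
    ∑' n, ∑' l, ‖kap b n l‖ₑ * ‖f l‖ₑ ≠ ⊤ := by
  simpa using kap_sum hs hf 0

lemma kap_summable {b : Fin 3 → Z3 → ℂ} (hs : SmoothV3 b) {f : Z3 → ℂ} (hf : L1W f) (n : Z3) :
    Summable fun l => kap b n l * f l := by
  apply summable_of_enorm
  simp_rw [enorm_mul]
  exact ENNReal.ne_top_of_tsum_ne_top (kap_sum0 hs hf) n

lemma transport_eq {b : Fin 3 → Z3 → ℂ} (hs : SmoothV3 b) {f : Z3 → ℂ} (hf : L1W f) (n : Z3) :
    transport b f n = ∑' l, kap b n l * f l := by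
  unfold transport conv
  have h1 : ∀ j : Fin 3, Summable fun l => b j (n - l) * pd j f l := by
    intro j
    apply summable_of_enorm
    have := kap_sum0 hs hf
    -- bound through the convolution of ℓ¹ functions
    have h2 : ∑' n, cv (fun m => bmE b m) (fun l => ‖f l‖ₑ * jw l) n ≠ ⊤ := by
      rw [tsum_cv]
      exact ENNReal.mul_ne_top (by simpa [N1] using bmE_sum hs 0) (by simpa [N1] using hf 1)
    refine ne_top_of_le_ne_top (ENNReal.ne_top_of_tsum_ne_top h2 n)
      (ENNReal.tsum_le_tsum fun l => ?_)
    rw [enorm_mul]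
    refine mul_le_mul' ?_ ?_
    · show _ ≤ bmE b (n - l)
      rw [bmE_eq]
      exact Finset.single_le_sum (f := fun j => ‖b j (n - l)‖ₑ) (fun _ _ => zero_le)
        (Finset.mem_univ j)
    · show _ ≤ ‖f l‖ₑ * jw l
      unfold pd jw
      rw [enorm_mul, mul_comm]
      gcongr
      rw [← ofReal_norm, norm_mul, Complex.norm_I, one_mul, Complex.norm_real,
        Real.norm_eq_abs]
      apply ENNReal.ofReal_le_ofReal
      linarith [abs_comp_le l j]
  have h2 : ∀ j : Fin 3, ∑' m, b j m * pd j f (n - m) = ∑' l, b j (n - l) * pd j f l := by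
    intro j
    rw [← (Equiv.subLeft n).tsum_eq]
    simp [Equiv.subLeft]
  simp_rw [h2]
  rw [← Summable.tsum_finsetSum fun j _ => h1 j]
  refine tsum_congr fun l => ?_
  unfold kap dotb pd
  rw [Finset.mul_sum, Finset.sum_mul]
  refine Finset.sum_congr rfl fun j _ => ?_
  ring

lemma transport_enorm_le {b : Fin 3 → Z3 → ℂ} (hs : SmoothV3 b) {f : Z3 → ℂ} (hf : L1W f) (n : Z3) :
    ‖transport b f n‖ₑ ≤ ∑' l, ‖kap b n l‖ₑ * ‖f l‖ₑ := by
  rw [transport_eq hs hf]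
  refine enorm_tsum_le_tsum_enorm.trans (le_of_eq ?_)
  simp_rw [enorm_mul]

lemma L1W.transport {b : Fin 3 → Z3 → ℂ} (hs : SmoothV3 b) {f : Z3 → ℂ} (hf : L1W f) :
    L1W (transport b f) :=
  L1W.mono (kap_sum hs hf) (transport_enorm_le hs hf)

/-- complex inner product -/
def ip (c d : Z3 → ℂ) : ℂ := ∑' n : Z3, c n * (starRingEnd ℂ) (d n)

lemma ip_anti {b : Fin 3 → Z3 → ℂ} (hb : DivFree b) (hs : SmoothV3 b) {f g : Z3 → ℂ}
    (hf : L1W f) (hg : L1W g) : ip (transport b f) g = - ip f (transport b g) := by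
  unfold ip
  have hS : Summable (Function.uncurry fun n l => kap b n l * f l * (starRingEnd ℂ) (g n)) := by
    apply summable_of_enorm
    rw [ENNReal.tsum_prod']
    refine ne_top_of_le_ne_top (ENNReal.mul_ne_top (kap_sum0 hs hf) hg.tsum_ne_top) ?_
    rw [← ENNReal.tsum_mul_right]
    refine ENNReal.tsum_le_tsum fun n => ?_
    rw [← ENNReal.tsum_mul_right]
    refine ENNReal.tsum_le_tsum fun l => ?_
    simp only [Function.uncurry, enorm_mul, RCLike.enorm_conj]
    gcongr
    exact ENNReal.le_tsum (f := fun n => ‖g n‖ₑ) n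
  calc ∑' n, transport b f n * (starRingEnd ℂ) (g n)
      = ∑' n, ∑' l, kap b n l * f l * (starRingEnd ℂ) (g n) := by
        refine tsum_congr fun n => ?_
        rw [transport_eq hs hf, tsum_mul_right]
    _ = ∑' l, ∑' n, kap b n l * f l * (starRingEnd ℂ) (g n) := hS.tsum_comm.symm
    _ = ∑' l, -(f l * (starRingEnd ℂ) (transport b g l)) := by
        refine tsum_congr fun l => ?_
        rw [transport_eq hs hg, Complex.conj_tsum, ← tsum_mul_left, ← tsum_neg]
        refine tsum_congr fun n => ?_
        rw [map_mul, kap_anti hb hs]; ring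
    _ = _ := tsum_neg
end

section
open scoped BigOperators ENNReal
open Complex

lemma den_ne {n : Z3} (h : ¬(n 0 = 0 ∧ n 1 = 0)) : ((n 0 : ℂ)) ^ 2 + ((n 1 : ℂ)) ^ 2 ≠ 0 := by
  have h1 : (n 0) ^ 2 + (n 1) ^ 2 ≠ 0 := by
    intro h0
    apply h
    constructor <;> nlinarith [sq_nonneg (n 0), sq_nonneg (n 1)]
  exact_mod_cast h1

lemma hproj_ip_pt (X Y : Fin 2 → Z3 → ℂ) (n : Z3) :
    ∑ i, hproj X i n * (starRingEnd ℂ) (Y i n) = ∑ i, X i n * (starRingEnd ℂ) (hproj Y i n) := by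
  unfold hproj
  split_ifs with h
  · have hd := den_ne h.2
    simp only [Fin.sum_univ_two, map_sub, map_mul, map_div₀, map_add, map_pow, map_intCast,
      Fin.castSucc_zero, Fin.castSucc_one]
    field_simp
    ring
  · rfl

lemma hproj_lam (s : ℝ) (Y : Fin 2 → Z3 → ℂ) : hproj (lamV s Y) = lamV s (hproj Y) := by
  funext i n
  simp only [hproj, lamV, lam]
  split_ifs with h
  · ring
  · rfl

lemma hproj_idem (X : Fin 2 → Z3 → ℂ) : hproj (hproj X) = hproj X := by
  funext i n
  unfold hproj
  split_ifs with h
  · have hd := den_ne h.2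
    simp only [Fin.castSucc_zero, Fin.castSucc_one]
    field_simp
    ring
  · rfl

lemma norm_q_le (X : Fin 2 → Z3 → ℂ) (i : Fin 2) (n : Z3) (h : ¬(n 0 = 0 ∧ n 1 = 0)) :
    ‖(n i.castSucc : ℂ) * ((n 0 : ℂ) * X 0 n + (n 1 : ℂ) * X 1 n) /
      (((n 0 : ℂ)) ^ 2 + ((n 1 : ℂ)) ^ 2)‖ ≤ ‖X 0 n‖ + ‖X 1 n‖ := by
  have hd : (0 : ℝ) < (n 0 : ℝ) ^ 2 + (n 1 : ℝ) ^ 2 := by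
    have h1 : (n 0) ^ 2 + (n 1) ^ 2 ≠ 0 := by
      intro h0
      apply h
      constructor <;> nlinarith [sq_nonneg (n 0), sq_nonneg (n 1)]
    have h1 : ((n 0 : ℝ)) ^ 2 + ((n 1 : ℝ)) ^ 2 ≠ 0 := by exact_mod_cast h1
    positivity
  have e : (((n 0 : ℂ)) ^ 2 + ((n 1 : ℂ)) ^ 2) = (((n 0 : ℝ) ^ 2 + (n 1 : ℝ) ^ 2 : ℝ) : ℂ) := by
    push_cast; rfl
  rw [norm_div, e, Complex.norm_real, Real.norm_of_nonneg hd.le, div_le_iff₀ hd, norm_mul]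
  have h1 : ‖(n 0 : ℂ) * X 0 n + (n 1 : ℂ) * X 1 n‖ ≤ |(n 0 : ℝ)| * ‖X 0 n‖ + |(n 1 : ℝ)| * ‖X 1 n‖ := by
    refine (norm_add_le _ _).trans (le_of_eq ?_)
    rw [norm_mul, norm_mul, Complex.norm_intCast, Complex.norm_intCast]
  rw [Complex.norm_intCast]
  have hi : |(n i.castSucc : ℝ)| = |(n 0 : ℝ)| ∨ |(n i.castSucc : ℝ)| = |(n 1 : ℝ)| := by
    fin_cases i
    · left; rfl
    · right; rfl
  have k : ∀ a c : ℝ, 0 ≤ a → 0 ≤ c → a * c ≤ a ^ 2 + c ^ 2 := fun a c _ _ => by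
    nlinarith [sq_nonneg (a - c)]
  rw [← sq_abs (n 0 : ℝ), ← sq_abs (n 1 : ℝ)]
  set p := |(n 0 : ℝ)|
  set q := |(n 1 : ℝ)|
  have p0 : 0 ≤ p := abs_nonneg _
  have q0 : 0 ≤ q := abs_nonneg _
  have x0 := norm_nonneg (X 0 n)
  have x1 := norm_nonneg (X 1 n)
  rcases hi with hi | hi <;> rw [hi]
  · calc _ ≤ p * (p * ‖X 0 n‖ + q * ‖X 1 n‖) := by gcongr
      _ ≤ _ := by nlinarith [mul_le_mul_of_nonneg_right (k p q p0 q0) x1, mul_nonneg (sq_nonneg q) x0]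
  · calc _ ≤ q * (p * ‖X 0 n‖ + q * ‖X 1 n‖) := by gcongr
      _ ≤ _ := by nlinarith [mul_le_mul_of_nonneg_right (k p q p0 q0) x0, mul_nonneg (sq_nonneg p) x1]

lemma norm_qproj_le (X : Fin 2 → Z3 → ℂ) (i : Fin 2) (n : Z3) :
    ‖qproj X i n‖ ≤ ‖X 0 n‖ + ‖X 1 n‖ := by
  unfold qproj hproj
  simp only [Pi.sub_apply]
  split_ifs with h
  · rw [sub_sub_cancel]
    exact norm_q_le X i n h.2
  · simp; positivity

lemma L1W.qproj {X : Fin 2 → Z3 → ℂ} (hX : ∀ i, L1W (X i)) (i : Fin 2) : L1W (qproj X i) := by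
  refine L1W.mono (F := fun n => ‖X 0 n‖ₑ + ‖X 1 n‖ₑ) (fun N => ?_) (fun n => ?_)
  · simp_rw [add_mul]
    rw [ENNReal.tsum_add]
    exact ENNReal.add_ne_top.mpr ⟨hX 0 N, hX 1 N⟩
  · rw [← ofReal_norm, ← ofReal_norm, ← ofReal_norm,
      ← ENNReal.ofReal_add (norm_nonneg _) (norm_nonneg _)]
    exact ENNReal.ofReal_le_ofReal (norm_qproj_le X i n)

lemma L1W.hproj {X : Fin 2 → Z3 → ℂ} (hX : ∀ i, L1W (X i)) (i : Fin 2) : L1W (hproj X i) := by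
  have := (hX i).sub (L1W.qproj hX i)
  convert this using 1
  funext n
  simp [_root_.qproj]

lemma hproj_ip {X Y : Fin 2 → Z3 → ℂ} (hX : ∀ i, L1W (X i)) (hY : ∀ i, L1W (Y i)) :
    ∑ i, ip (hproj X i) (Y i) = ∑ i, ip (X i) (hproj Y i) := by
  unfold ip
  rw [← Summable.tsum_finsetSum fun i _ => (L1W.hproj hX i).mul_summable (hY i),
    ← Summable.tsum_finsetSum fun i _ => (hX i).mul_summable (L1W.hproj hY i)]
  exact tsum_congr fun n => hproj_ip_pt X Y n

lemma ip_sub_right {f g h : Z3 → ℂ} (hf : L1W f) (hg : L1W g) (hh : L1W h) :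
    ip f (g - h) = ip f g - ip f h := by
  unfold ip
  rw [← (hf.mul_summable hg).tsum_sub (hf.mul_summable hh)]
  exact tsum_congr fun n => by simp only [Pi.sub_apply, map_sub]; ring

lemma ip_sub_left {f g h : Z3 → ℂ} (hf : L1W f) (hg : L1W g) (hh : L1W h) :
    ip (f - g) h = ip f h - ip g h := by
  unfold ip
  rw [← (hf.mul_summable hh).tsum_sub (hg.mul_summable hh)]
  exact tsum_congr fun n => by simp only [Pi.sub_apply]; ring

lemma l2sq_lam {σ : ℝ} (c : Z3 → ℂ) : ((l2sq (lam σ c) : ℝ) : ℂ) = ip c (lam (2 * σ) c) := by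
  unfold l2sq ip
  rw [Complex.ofReal_tsum]
  refine tsum_congr fun n => ?_
  unfold lam
  have k0 := knorm_nonneg n
  rw [norm_mul, Complex.norm_real, Real.norm_of_nonneg (Real.rpow_nonneg k0 _), map_mul,
    Complex.conj_ofReal, mul_pow]
  have : (knorm n ^ σ) ^ 2 = knorm n ^ (2 * σ) := by
    rw [← Real.rpow_natCast, ← Real.rpow_mul k0]; congr 1; push_cast; ring
  rw [this]
  push_cast
  rw [← Complex.mul_conj']
  ring

lemma L1W.commLam {s : ℝ} (hs0 : 0 ≤ s) {b : Fin 3 → Z3 → ℂ} (hs : SmoothV3 b) {f : Z3 → ℂ}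
    (hf : L1W f) : L1W (commLam s b f) :=
  ((hf.transport hs).lam hs0).sub ((hf.lam hs0).transport hs)

lemma qty_eq {σ : ℝ} (hσ : 0 ≤ σ) {b : Fin 3 → Z3 → ℂ} (hs : SmoothV3 b) (hb : DivFree b)
    {V : Fin 2 → Z3 → ℂ} (hV : ∀ i, L1W (V i)) (hP : hproj V = V) :
    inner2V (PB b (PB b V)) (lamV (2 * σ) V) + (l2normV (lamV σ (PB b V))) ^ 2 =
      (∑ i, ip (transport b (V i)) (commLam (2 * σ) b (V i))).re -
      (∑ i, ip (qproj (transportV b V) i) (commLam (2 * σ) b (V i))).re := by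
  have h2σ : 0 ≤ 2 * σ := by linarith
  have hBV : ∀ i, L1W (transportV b V i) := fun i => (hV i).transport hs
  have hU : ∀ i, L1W (PB b V i) := fun i => L1W.hproj hBV i
  have hBU : ∀ i, L1W (transportV b (PB b V) i) := fun i => (hU i).transport hs
  have hDV : ∀ i, L1W (lamV (2 * σ) V i) := fun i => (hV i).lam h2σ
  have hDU : ∀ i, L1W (lamV (2 * σ) (PB b V) i) := fun i => (hU i).lam h2σ
  have hDBV : ∀ i, L1W (lamV (2 * σ) (transportV b V) i) := fun i => (hBV i).lam h2σ
  have hC : ∀ i, L1W (commLam (2 * σ) b (V i)) := fun i => (hV i).commLam h2σ hs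
  have hl : (l2normV (lamV σ (PB b V))) ^ 2 = (∑ i, ip (PB b V i) (lamV (2 * σ) (PB b V) i)).re := by
    unfold l2normV
    rw [Real.sq_sqrt (Finset.sum_nonneg fun i _ =>
      (show 0 ≤ l2sq _ from tsum_nonneg fun n => by positivity))]
    rw [← Complex.ofReal_re (∑ i, _), Complex.ofReal_sum]
    congr 1
    exact Finset.sum_congr rfl fun i _ => l2sq_lam _
  have h1 : inner2V (PB b (PB b V)) (lamV (2 * σ) V) =
      (∑ i, ip (PB b (PB b V) i) (lamV (2 * σ) V i)).re := by
    unfold inner2V inner2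
    rw [Complex.re_sum]; rfl
  have h2 : ∑ i, ip (PB b (PB b V) i) (lamV (2 * σ) V i) =
      - ∑ i, ip (PB b V i) (transport b (lam (2 * σ) (V i))) := by
    have := hproj_ip hBU hDV
    rw [hproj_lam, hP] at this
    refine this.trans ?_
    rw [← Finset.sum_neg_distrib]
    exact Finset.sum_congr rfl fun i _ => ip_anti hb hs (hU i) (hDV i)
  have h3 : ∑ i, ip (PB b V i) (lamV (2 * σ) (PB b V) i) =
      ∑ i, ip (PB b V i) (lam (2 * σ) (transport b (V i))) := by
    have := hproj_ip hU hDBV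
    rw [hproj_lam] at this
    refine this.symm.trans ?_
    have e : hproj (PB b V) = PB b V := hproj_idem _
    rw [e]
    rfl
  rw [h1, hl, h2, h3, ← Complex.add_re, ← Complex.sub_re]
  congr 1
  rw [← Finset.sum_neg_distrib, ← Finset.sum_add_distrib, ← Finset.sum_sub_distrib]
  refine Finset.sum_congr rfl fun i _ => ?_
  have e1 : PB b V i = transport b (V i) - qproj (transportV b V) i := by
    unfold qproj PB transportV; simp
  have e3 := ip_sub_left (f := transport b (V i)) (hBV i) (L1W.qproj hBV i) (hC i)
  rw [← e3, ← e1]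
  have := ip_sub_right (hU i) (hDBV i) ((hDV i).transport hs)
  have e2 : commLam (2 * σ) b (V i) = lamV (2 * σ) (transportV b V) i - transport b (lamV (2 * σ) V i) := rfl
  rw [e2, this]
  simp only [lamV, transportV]
  ring
end

section
open scoped BigOperators ENNReal
open Complex

lemma commLam_eq {s : ℝ} (hs0 : 0 ≤ s) {b : Fin 3 → Z3 → ℂ} (hs : SmoothV3 b) {f : Z3 → ℂ}
    (hf : L1W f) (n : Z3) :
    commLam s b f n = ∑' l, ((knorm n ^ s - knorm l ^ s : ℝ) : ℂ) * kap b n l * f l := by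
  have h1 := kap_summable hs hf n
  have h2 := kap_summable hs (hf.lam hs0) n
  unfold commLam
  rw [Pi.sub_apply, transport_eq hs (hf.lam hs0)]
  conv_lhs => enter [1]; unfold lam
  rw [transport_eq hs hf, ← tsum_mul_left, ← (h1.mul_left _).tsum_sub h2]
  refine tsum_congr fun l => ?_
  unfold lam
  push_cast
  ring

/-- kernel of the trilinear form -/
def Gk (s : ℝ) (b : Fin 3 → Z3 → ℂ) (f : Z3 → ℂ) (t : Z3 × Z3 × Z3) : ℂ :=
  ((knorm t.2.2 ^ s - knorm t.1 ^ s : ℝ) : ℂ) * kap b t.2.2 t.1 * kap b t.1 t.2.1 *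
    f t.2.1 * (starRingEnd ℂ) (f t.2.2)

def Hk (s : ℝ) (b : Fin 3 → Z3 → ℂ) (f : Z3 → ℂ) (t : Z3 × Z3 × Z3) : ℂ :=
  ((knorm t.2.2 ^ s + knorm t.2.1 ^ s - 2 * knorm t.1 ^ s : ℝ) : ℂ) * kap b t.2.2 t.1 *
    kap b t.1 t.2.1 * f t.2.1 * (starRingEnd ℂ) (f t.2.2)

def swapE : Z3 × Z3 × Z3 ≃ Z3 × Z3 × Z3 where
  toFun t := (t.1, t.2.2, t.2.1)
  invFun t := (t.1, t.2.2, t.2.1)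
  left_inv t := rfl
  right_inv t := rfl

def reflE : Z3 × Z3 × Z3 ≃ Z3 × Z3 × Z3 where
  toFun t := (t.2.2 + t.2.1 - t.1, t.2.1, t.2.2)
  invFun t := (t.2.2 + t.2.1 - t.1, t.2.1, t.2.2)
  left_inv t := by simp
  right_inv t := by simp

lemma enorm_kap_symm {b : Fin 3 → Z3 → ℂ} (hb : DivFree b) (hs : SmoothV3 b) (n l : Z3) :
    ‖kap b n l‖ₑ = ‖kap b l n‖ₑ := by
  have := kap_anti hb hs n l
  rw [← RCLike.enorm_conj (K := ℂ) (kap b n l), this, enorm_neg]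

lemma tsum_mul_le {ι : Type*} (u v : ι → ℝ≥0∞) : ∑' i, u i * v i ≤ (∑' i, u i) * ∑' i, v i := by
  rw [← ENNReal.tsum_mul_right]
  exact ENNReal.tsum_le_tsum fun i => by gcongr; exact ENNReal.le_tsum i

lemma Gk_summable {s : ℝ} (hs0 : 0 ≤ s) {b : Fin 3 → Z3 → ℂ} (hb : DivFree b) (hs : SmoothV3 b)
    {f : Z3 → ℂ} (hf : L1W f) : Summable (Gk s b f) := by
  apply summable_of_enorm
  rw [ENNReal.tsum_prod']
  set A : Z3 → ℝ≥0∞ := fun p => ∑' l, ‖kap b p l‖ₑ * ‖f l‖ₑ with hA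
  set A' : Z3 → ℝ≥0∞ := fun p => ∑' l, ‖kap b p l‖ₑ * ‖lam s f l‖ₑ with hA'
  have hle : ∀ p, ∑' q : Z3 × Z3, ‖Gk s b f (p, q)‖ₑ ≤ A p * (A p * jw p ^ ⌈s⌉₊ + A' p) := by
    intro p
    rw [ENNReal.tsum_prod']
    have : A p * jw p ^ ⌈s⌉₊ + A' p = ∑' n, (‖kap b p n‖ₑ * ‖f n‖ₑ * jw p ^ ⌈s⌉₊ +
        ‖kap b p n‖ₑ * ‖lam s f n‖ₑ) := by
      rw [ENNReal.tsum_add, ENNReal.tsum_mul_right]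
    rw [this, hA, tsum_mul_tsum']
    refine ENNReal.tsum_le_tsum fun l => ENNReal.tsum_le_tsum fun n => ?_
    simp only [Gk, enorm_mul, RCLike.enorm_conj]
    have h1 : ‖((knorm n ^ s - knorm p ^ s : ℝ) : ℂ)‖ₑ ≤
        ENNReal.ofReal (knorm n ^ s) + jw p ^ ⌈s⌉₊ := by
      rw [← ofReal_norm, Complex.norm_real, Real.norm_eq_abs]
      have k1 := Real.rpow_nonneg (knorm_nonneg n) s
      have k2 := Real.rpow_nonneg (knorm_nonneg p) s
      refine le_trans ?_ (add_le_add_right (knorm_rpow_le_jw hs0 p) _)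
      rw [← ENNReal.ofReal_add k1 k2]
      apply ENNReal.ofReal_le_ofReal
      rw [abs_le]; constructor <;> linarith
    have h2 : ‖lam s f n‖ₑ = ENNReal.ofReal (knorm n ^ s) * ‖f n‖ₑ := by
      unfold lam
      rw [enorm_mul, ← ofReal_norm, Complex.norm_real,
        Real.norm_of_nonneg (Real.rpow_nonneg (knorm_nonneg n) s)]
    rw [h2, enorm_kap_symm hb hs n p]
    calc _ ≤ (ENNReal.ofReal (knorm n ^ s) + jw p ^ ⌈s⌉₊) * ‖kap b p n‖ₑ * ‖kap b p l‖ₑ *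
          ‖f l‖ₑ * ‖f n‖ₑ := by gcongr
      _ = _ := by ring
  refine ne_top_of_le_ne_top ?_ (ENNReal.tsum_le_tsum hle)
  refine ne_top_of_le_ne_top ?_ (tsum_mul_le _ _)
  rw [ENNReal.tsum_add]
  exact ENNReal.mul_ne_top (kap_sum0 hs hf) (ENNReal.add_ne_top.mpr
    ⟨kap_sum hs hf _, kap_sum0 hs (hf.lam hs0)⟩)

lemma comm_term_summable {s : ℝ} (hs0 : 0 ≤ s) {b : Fin 3 → Z3 → ℂ} (hs : SmoothV3 b) {f : Z3 → ℂ}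
    (hf : L1W f) (n : Z3) :
    Summable fun l => ((knorm n ^ s - knorm l ^ s : ℝ) : ℂ) * kap b n l * f l := by
  have h1 := (kap_summable hs hf n).mul_left ((knorm n ^ s : ℝ) : ℂ)
  have h2 := kap_summable hs (hf.lam hs0) n
  refine (h1.sub h2).congr fun l => ?_
  unfold lam
  push_cast
  ring

lemma ip_eq_G {s : ℝ} (hs0 : 0 ≤ s) {b : Fin 3 → Z3 → ℂ} (hb : DivFree b) (hs : SmoothV3 b)
    {f : Z3 → ℂ} (hf : L1W f) : ip (transport b f) (commLam s b f) = ∑' t, Gk s b f t := by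
  have hG := Gk_summable hs0 hb hs hf
  rw [hG.tsum_prod]
  unfold ip
  refine tsum_congr fun p => ?_
  rw [transport_eq hs hf, commLam_eq hs0 hs hf, Complex.conj_tsum]
  rw [tsum_mul_tsum_of_summable_norm (kap_summable hs hf p).norm
    ((comm_term_summable hs0 hs hf p).norm.congr fun l => by rw [RCLike.norm_conj])]
  refine tsum_congr fun q => ?_
  simp only [Gk, map_mul, Complex.conj_ofReal]
  rw [kap_anti hb hs]
  push_cast
  ring

lemma four_re {s : ℝ} (hs0 : 0 ≤ s) {b : Fin 3 → Z3 → ℂ} (hb : DivFree b) (hs : SmoothV3 b)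
    {f : Z3 → ℂ} (hf : L1W f) :
    ((4 * (ip (transport b f) (commLam s b f)).re : ℝ) : ℂ) =
      ∑' t, (Hk s b f t + Hk s b f (reflE t)) := by
  have hG := Gk_summable hs0 hb hs hf
  have hG' : Summable fun t => (starRingEnd ℂ) (Gk s b f (swapE t)) := by
    have := (swapE.summable_iff.mpr hG)
    refine Summable.of_norm (this.norm.congr fun t => ?_)
    rw [RCLike.norm_conj]; rfl
  have e : ∀ t, Gk s b f t + (starRingEnd ℂ) (Gk s b f (swapE t)) = Hk s b f t := by
    intro t
    simp only [Gk, Hk, swapE, Equiv.coe_fn_mk, map_mul, Complex.conj_ofReal, Complex.conj_conj]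
    rw [kap_anti hb hs, kap_anti hb hs]
    push_cast
    ring
  have hH : Summable (Hk s b f) := (hG.add hG').congr e
  have hH' : Summable fun t => Hk s b f (reflE t) := reflE.summable_iff.mpr hH
  have h1 : ((2 * (ip (transport b f) (commLam s b f)).re : ℝ) : ℂ) = ∑' t, Hk s b f t := by
    rw [← Complex.add_conj, ip_eq_G hs0 hb hs hf, Complex.conj_tsum,
      ← swapE.tsum_eq (fun t => (starRingEnd ℂ) (Gk s b f t)), ← hG.tsum_add hG']
    exact tsum_congr e
  rw [hH.tsum_add hH', reflE.tsum_eq (Hk s b f), ← h1]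
  push_cast
  ring
end

section
open scoped BigOperators ENNReal
open Complex

def wR (s : ℝ) (f : Z3 → ℂ) (n : Z3) : ℝ := knorm n ^ s * ‖f n‖
def bR (s : ℝ) (b : Fin 3 → Z3 → ℂ) (m : Z3) : ℝ := knorm m ^ s * bm b m

def CH (σ : ℝ) : ℝ := (2 * (2 * σ * (2 * σ - 1)) + 2 * σ * 20 + 2 * σ * 20) * 27 ^ σ

lemma wR_nonneg (s : ℝ) (f : Z3 → ℂ) (n : Z3) : 0 ≤ wR s f n :=
  mul_nonneg (Real.rpow_nonneg (knorm_nonneg _) _) (norm_nonneg _)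
lemma bR_nonneg (s : ℝ) (b : Fin 3 → Z3 → ℂ) (n : Z3) : 0 ≤ bR s b n :=
  mul_nonneg (Real.rpow_nonneg (knorm_nonneg _) _) (bm_nonneg _ _)

lemma knorm_tri (m n l : Z3) (h : n = m + l) : knorm n ≤ knorm m + knorm l := by
  have := knorm_sub_le n l
  rw [h, add_sub_cancel_right] at this
  rwa [h]

lemma knorm_diff {s M : ℝ} (hs : 1 ≤ s) (n l : Z3) (hn : knorm n ≤ M) (hl : knorm l ≤ M) :
    |knorm n ^ s - knorm l ^ s| ≤ s * M ^ (s - 1) * knorm (n - l) := by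
  rw [knorm_eq] at *
  rw [knorm_eq] at *
  rw [knorm_eq, ev_sub]
  exact norm_rpow_diff hs hn hl

lemma norm_dotb_le' {b : Fin 3 → Z3 → ℂ} (hb : DivFree b) (m l p : Z3) (h : p = l + m) :
    ‖dotb b m l‖ ≤ bm b m * min (knorm l) (knorm p) := by
  rw [mul_min_of_nonneg _ _ (bm_nonneg _ _)]
  refine le_min (norm_dotb_le _ _ _) ?_
  have : dotb b m l = dotb b m p := by rw [h, dotb_add, dotb_self hb, add_zero]
  rw [this]
  exact norm_dotb_le _ _ _

lemma H_bound {σ : ℝ} (hσ : 3 < σ) {b : Fin 3 → Z3 → ℂ} (hb : DivFree b)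
    (hb0 : ∀ j, b j 0 = 0) {f : Z3 → ℂ} (hf0 : f 0 = 0) (l m₁ m₂ : Z3) :
    ‖Hk (2 * σ) b f (l + m₂, l, l + m₁ + m₂) + Hk (2 * σ) b f (l + m₁, l, l + m₁ + m₂)‖ ≤
      CH σ * (bR (σ + 1) b m₁ * bR (σ + 1) b m₂ * wR σ f l * wR σ f (l + m₁ + m₂)) := by
  by_cases hl : l = 0
  · simp [Hk, hl, hf0, wR]
  by_cases hn : l + m₁ + m₂ = 0
  · simp [Hk, hn, hf0, wR]
  set n := l + m₁ + m₂ with hndef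
  set a := knorm l with ha
  set c := knorm m₁ with hc
  set d := knorm m₂ with hd
  set e := knorm n with he
  set p := l + m₂ with hp
  set p' := l + m₁ with hp'
  set D := knorm n ^ (2 * σ) + knorm l ^ (2 * σ) - 2 * knorm p ^ (2 * σ) with hD
  set D' := knorm n ^ (2 * σ) + knorm l ^ (2 * σ) - 2 * knorm p' ^ (2 * σ) with hD'
  have hbm0 : bm b 0 = 0 := by simp [bm, hb0]
  have a0 : 0 ≤ a := knorm_nonneg _
  have c0 : 0 ≤ c := knorm_nonneg _
  have d0 : 0 ≤ d := knorm_nonneg _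
  have e0 : 0 ≤ e := knorm_nonneg _
  have pc : knorm p ≤ a + d := knorm_tri l p m₂ rfl
  have pc' : knorm p' ≤ a + c := knorm_tri l p' m₁ rfl
  have pe : knorm p ≤ e + c := by
    rw [hc, ← knorm_neg m₁]; exact knorm_tri n p (-m₁) (by rw [hndef, hp, hp']; abel)
  have pe' : knorm p' ≤ e + d := by
    rw [hd, ← knorm_neg m₂]; exact knorm_tri n p' (-m₂) (by rw [hndef, hp']; abel)
  have ne : e ≤ a + c + d := (knorm_tri p' n m₂ rfl).trans (by linarith)
  have la : a ≤ knorm p + d := by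
    rw [hd, ← knorm_neg m₂]; exact knorm_tri p l (-m₂) (by rw [hp]; abel)
  have h1 : a ≤ c + d + e := by linarith
  have cp : c ≤ knorm p' + a := by
    rw [ha, ← knorm_neg l]; exact knorm_tri p' m₁ (-l) (by rw [hp']; abel)
  have h2 : c ≤ a + d + e := by linarith
  have dp : d ≤ knorm p + a := by
    rw [ha, ← knorm_neg l]; exact knorm_tri p m₂ (-l) (by rw [hp]; abel)
  have h3 : d ≤ a + c + e := by linarith
  set x₁ := dotb b m₁ l
  set x₂ := dotb b m₂ l
  set y₁ := dotb b m₁ m₂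
  set y₂ := dotb b m₂ m₁
  have k1 : kap b n p = I * (x₁ + y₁) := by
    unfold kap
    rw [show n - p = m₁ by rw [hndef, hp, hp']; abel, hp, dotb_add]
  have k2 : kap b p l = I * x₂ := by
    unfold kap
    rw [show p - l = m₂ by rw [hp]; abel]
  have k3 : kap b n p' = I * (x₂ + y₂) := by
    unfold kap
    rw [show n - p' = m₂ by rw [hndef, hp']; abel, hp', dotb_add]
  have k4 : kap b p' l = I * x₁ := by
    unfold kap
    rw [show p' - l = m₁ by rw [hp']; abel]
  have eq : Hk (2 * σ) b f (p, l, n) + Hk (2 * σ) b f (p', l, n) =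
      -(x₁ * x₂ * ((D + D' : ℝ) : ℂ) + y₁ * x₂ * (D : ℂ) + y₂ * x₁ * (D' : ℂ)) *
        (f l * (starRingEnd ℂ) (f n)) := by
    simp only [Hk, k1, k2, k3, k4, ← hD, ← hD']
    push_cast
    linear_combination (((x₁ + y₁) * x₂ * D + (x₂ + y₂) * x₁ * D') * (f l * (starRingEnd ℂ) (f n))) *
      Complex.I_sq
  set S := a + c + d with hS
  have S0 : 0 ≤ S := by positivity
  have hDD : |D + D'| ≤ 2 * (2 * σ * (2 * σ - 1) * S ^ (2 * σ - 2) * c * d) := by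
    have := second_diff (p := 2 * σ) (by linarith) (ev l) (ev m₁) (ev m₂)
    simp only [← ev_add, ← knorm_eq] at this
    have e1 : D + D' = 2 * (knorm n ^ (2 * σ) - knorm p' ^ (2 * σ) - knorm p ^ (2 * σ) +
      knorm l ^ (2 * σ)) := by rw [hD, hD']; ring
    rw [e1, abs_mul, abs_two]
    gcongr
  have hdiff : ∀ (q r₁ r₂ : Z3), n = q + r₁ → q = l + r₂ → knorm q ≤ S →
      |knorm n ^ (2 * σ) + knorm l ^ (2 * σ) - 2 * knorm q ^ (2 * σ)| ≤
        2 * σ * S ^ (2 * σ - 1) * (knorm r₁ + knorm r₂) := by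
    intro q r₁ r₂ hq1 hq2 hqS
    have i1 := knorm_diff (s := 2 * σ) (M := S) (by linarith) n q ne hqS
    have i2 := knorm_diff (s := 2 * σ) (M := S) (by linarith) q l hqS (by show a ≤ S; linarith)
    rw [show n - q = r₁ by rw [hq1]; abel] at i1
    rw [show q - l = r₂ by rw [hq2]; abel] at i2
    rw [abs_le] at *
    constructor <;> nlinarith [i1.1, i1.2, i2.1, i2.2]
  have hDb : |D| ≤ 2 * σ * S ^ (2 * σ - 1) * (c + d) :=
    hdiff p m₁ m₂ (by rw [hndef, hp, hp']; abel) rfl (by linarith)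
  have hDb' : |D'| ≤ 2 * σ * S ^ (2 * σ - 1) * (d + c) :=
    hdiff p' m₂ m₁ rfl rfl (by linarith)
  have bx₁ : ‖x₁‖ ≤ bm b m₁ * a := norm_dotb_le _ _ _
  have bx₂ : ‖x₂‖ ≤ bm b m₂ * a := norm_dotb_le _ _ _
  have by₁ : ‖y₁‖ ≤ bm b m₁ * d := norm_dotb_le _ _ _
  have by₂ : ‖y₂‖ ≤ bm b m₂ * c := norm_dotb_le _ _ _
  set μ := min a (knorm p) with hμ
  set μ' := min a (knorm p') with hμ'
  have bx₂' : ‖x₂‖ ≤ bm b m₂ * μ := norm_dotb_le' hb _ _ _ rfl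
  have bx₁' : ‖x₁‖ ≤ bm b m₁ * μ' := norm_dotb_le' hb _ _ _ rfl
  have μ0 : 0 ≤ μ := le_min a0 (knorm_nonneg _)
  have μ0' : 0 ≤ μ' := le_min a0 (knorm_nonneg _)
  have B1 := bm_nonneg b m₁
  have B2 := bm_nonneg b m₂
  have sp1 : 0 ≤ S ^ (2 * σ - 1) := Real.rpow_nonneg S0 _
  have sp2 : 0 ≤ S ^ (2 * σ - 2) := Real.rpow_nonneg S0 _
  have s1 : 0 ≤ 2 * σ - 1 := by linarith
  have s2 : 0 ≤ σ := by linarith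
  have Q : ‖x₁ * x₂ * ((D + D' : ℝ) : ℂ) + y₁ * x₂ * (D : ℂ) + y₂ * x₁ * (D' : ℂ)‖ ≤
      bm b m₁ * bm b m₂ * (2 * (2 * σ * (2 * σ - 1)) * (c * d * a ^ 2 * S ^ (2 * σ - 2)) +
        2 * σ * (d * μ * (c + d) * S ^ (2 * σ - 1)) +
        2 * σ * (c * μ' * (d + c) * S ^ (2 * σ - 1))) := by
    refine (norm_add₃_le).trans ?_
    simp only [norm_mul, Complex.norm_real, Real.norm_eq_abs]
    calc _ ≤ (bm b m₁ * a) * (bm b m₂ * a) * (2 * (2 * σ * (2 * σ - 1) * S ^ (2 * σ - 2) * c * d)) +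
        (bm b m₁ * d) * (bm b m₂ * μ) * (2 * σ * S ^ (2 * σ - 1) * (c + d)) +
        (bm b m₂ * c) * (bm b m₁ * μ') * (2 * σ * S ^ (2 * σ - 1) * (d + c)) := by gcongr
      _ = _ := by ring
  rw [eq, norm_mul, norm_neg, norm_mul, RCLike.norm_conj]
  by_cases hm₁ : m₁ = 0
  · rw [hm₁, hbm0, zero_mul, zero_mul] at Q
    rw [le_antisymm Q (norm_nonneg _), zero_mul, hm₁]
    simp [bR, hbm0]
  by_cases hm₂ : m₂ = 0
  · rw [hm₂, hbm0, mul_zero, zero_mul] at Q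
    rw [le_antisymm Q (norm_nonneg _), zero_mul, hm₂]
    simp [bR, hbm0]
  have ha1 := one_le_knorm hl
  have he1 := one_le_knorm hn
  have hc1 := one_le_knorm hm₁
  have hd1 := one_le_knorm hm₂
  have q1 := pw1 hσ ha1 hc1 hd1 he1 h1 h2 h3
  have q2 := pw2 hσ ha1 hc1 hd1 he1 h1 h2 h3 μ0 (min_le_left _ _) ((min_le_right _ _).trans pe)
  have q3 := pw2 hσ ha1 hd1 hc1 he1 (by linarith) (by linarith) (by linarith) μ0' (min_le_left _ _)
    ((min_le_right _ _).trans pe')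
  change _ * S ^ _ ≤ _ at q1
  change _ * S ^ _ ≤ _ at q2
  rw [show knorm l + knorm m₂ + knorm m₁ = S by rw [hS, ha, hc, hd]; ring] at q3
  calc _ ≤ (bm b m₁ * bm b m₂ * (2 * (2 * σ * (2 * σ - 1)) *
          (27 ^ σ * (e ^ σ * a ^ σ * c ^ (σ + 1) * d ^ (σ + 1))) +
        2 * σ * (27 ^ σ * 20 * (e ^ σ * a ^ σ * c ^ (σ + 1) * d ^ (σ + 1))) +
        2 * σ * (27 ^ σ * 20 * (e ^ σ * a ^ σ * d ^ (σ + 1) * c ^ (σ + 1))))) * (‖f l‖ * ‖f n‖) := by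
        refine mul_le_mul_of_nonneg_right (Q.trans ?_) (by positivity)
        gcongr
    _ = _ := by
        unfold CH bR wR
        ring

lemma CH_nonneg {σ : ℝ} (hσ : 3 < σ) : 0 ≤ CH σ := by
  unfold CH
  have : 0 ≤ 2 * σ - 1 := by linarith
  positivity

def wE (s : ℝ) (f : Z3 → ℂ) (n : Z3) : ℝ≥0∞ := ENNReal.ofReal (wR s f n)
def bE (s : ℝ) (b : Fin 3 → Z3 → ℂ) (n : Z3) : ℝ≥0∞ := ENNReal.ofReal (bR s b n)

lemma bm_neg {b : Fin 3 → Z3 → ℂ} (hs : SmoothV3 b) (m : Z3) : bm b (-m) = bm b m := by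
  unfold bm
  exact Finset.sum_congr rfl fun j _ => by rw [(hs j).1 m, RCLike.norm_conj]

lemma bE_neg {b : Fin 3 → Z3 → ℂ} (hs : SmoothV3 b) (s : ℝ) (m : Z3) : bE s b (-m) = bE s b m := by
  unfold bE bR; rw [bm_neg hs, knorm_neg]

lemma main_term {σ : ℝ} (hσ : 3 < σ) {b : Fin 3 → Z3 → ℂ} (hb : DivFree b) (hs : SmoothV3 b)
    (hb0 : ∀ j, b j 0 = 0) {f : Z3 → ℂ} (hf : L1W f) (hf0 : f 0 = 0) :
    ENNReal.ofReal (4 * (ip (transport b f) (commLam (2 * σ) b f)).re) ≤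
      ENNReal.ofReal (CH σ) * ((N1 (bE (σ + 1) b) * N2 (wE σ f)) * (N1 (bE (σ + 1) b) * N2 (wE σ f))) := by
  have h4 := four_re (s := 2 * σ) (by linarith) hb hs hf
  calc ENNReal.ofReal (4 * (ip (transport b f) (commLam (2 * σ) b f)).re)
      ≤ ‖((4 * (ip (transport b f) (commLam (2 * σ) b f)).re : ℝ) : ℂ)‖ₑ := by
        rw [← ofReal_norm, Complex.norm_real]
        exact ENNReal.ofReal_le_ofReal (Real.le_norm_self _)
    _ ≤ ∑' t, ‖Hk (2 * σ) b f t + Hk (2 * σ) b f (reflE t)‖ₑ := by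
        rw [h4]; exact enorm_tsum_le_tsum_enorm
    _ ≤ ∑' t : Z3 × Z3 × Z3, ENNReal.ofReal (CH σ) * ((bE (σ + 1) b (t.1 - t.2.1) * wE σ f t.2.1) *
          (bE (σ + 1) b (t.1 - t.2.2) * wE σ f t.2.2)) := by
        refine ENNReal.tsum_le_tsum fun t => ?_
        obtain ⟨p, l, n⟩ := t
        have := H_bound hσ hb hb0 hf0 l (n - p) (p - l)
        rw [show l + (n - p) + (p - l) = n by abel, show l + (p - l) = p by abel,
          show l + (n - p) = n + l - p by abel] at this
        have hbs : bE (σ + 1) b (p - n) = bE (σ + 1) b (n - p) := by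
          rw [← bE_neg hs, neg_sub]
        simp only [reflE, Equiv.coe_fn_mk]
        rw [hbs, ← ofReal_norm]
        refine (ENNReal.ofReal_le_ofReal this).trans (le_of_eq ?_)
        have b1 := bR_nonneg (σ + 1) b (n - p)
        have b2 := bR_nonneg (σ + 1) b (p - l)
        have w1 := wR_nonneg σ f l
        rw [ENNReal.ofReal_mul (CH_nonneg hσ), ENNReal.ofReal_mul (by positivity),
          ENNReal.ofReal_mul (by positivity), ENNReal.ofReal_mul b1]
        simp only [bE, wE]
        ring
    _ = ENNReal.ofReal (CH σ) * ∑' p, cv (bE (σ + 1) b) (wE σ f) p * cv (bE (σ + 1) b) (wE σ f) p := by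
        rw [ENNReal.tsum_mul_left, ENNReal.tsum_prod']
        congr 1
        refine tsum_congr fun p => ?_
        rw [ENNReal.tsum_prod']
        unfold cv
        rw [tsum_mul_tsum']
    _ ≤ _ := by gcongr; exact cvcv _ _ _ _
end

section
open scoped BigOperators ENNReal
open Complex

def vR (V : Fin 2 → Z3 → ℂ) (n : Z3) : ℝ := ‖V 0 n‖ + ‖V 1 n‖
def wV (s : ℝ) (V : Fin 2 → Z3 → ℂ) (n : Z3) : ℝ≥0∞ := ENNReal.ofReal (knorm n ^ s * vR V n)
def aR (b : Fin 3 → Z3 → ℂ) (m : Z3) : ℝ := if m 2 = 0 then 0 else ‖b 0 m‖ + ‖b 1 m‖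
def aE (b : Fin 3 → Z3 → ℂ) (m : Z3) : ℝ≥0∞ := ENNReal.ofReal (aR b m)

lemma vR_nonneg (V : Fin 2 → Z3 → ℂ) (n : Z3) : 0 ≤ vR V n := by unfold vR; positivity
lemma aR_nonneg (b : Fin 3 → Z3 → ℂ) (n : Z3) : 0 ≤ aR b n := by unfold aR; split_ifs <;> positivity
lemma aR_le (b : Fin 3 → Z3 → ℂ) (n : Z3) : aR b n ≤ bm b n := by
  unfold aR bm
  rw [Fin.sum_univ_three]
  split_ifs
  · positivity
  · linarith [norm_nonneg (b 2 n)]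

lemma norm_le_vR (V : Fin 2 → Z3 → ℂ) (i : Fin 2) (n : Z3) : ‖V i n‖ ≤ vR V n := by
  unfold vR
  have h0 := norm_nonneg (V 0 n)
  have h1 := norm_nonneg (V 1 n)
  fin_cases i <;> simp

lemma wE_le_wV (s : ℝ) (V : Fin 2 → Z3 → ℂ) (i : Fin 2) (n : Z3) : wE s (V i) n ≤ wV s V n := by
  unfold wE wV wR
  apply ENNReal.ofReal_le_ofReal
  have := Real.rpow_nonneg (knorm_nonneg n) s
  gcongr
  exact norm_le_vR V i n

lemma comm_pt {σ : ℝ} (hσ : 3 < σ) {b : Fin 3 → Z3 → ℂ} (hb : DivFree b)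
    (hb0 : ∀ j, b j 0 = 0) (f : Z3 → ℂ) (n l : Z3) :
    ‖((knorm n ^ (2 * σ) - knorm l ^ (2 * σ) : ℝ) : ℂ) * kap b n l * f l‖ ≤
      (2 * σ * 4 ^ (2 * σ)) * (knorm n ^ σ * (bR σ b (n - l) * wR σ f l)) := by
  have hbm0 : bm b 0 = 0 := by simp [bm, hb0]
  have n0 := knorm_nonneg n
  have l0 := knorm_nonneg l
  have m0 := knorm_nonneg (n - l)
  have B := bm_nonneg b (n - l)
  have R : 0 ≤ (2 * σ * 4 ^ (2 * σ)) * (knorm n ^ σ * (bR σ b (n - l) * wR σ f l)) := by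
    have := bR_nonneg σ b (n - l)
    have := wR_nonneg σ f l
    have : 0 ≤ σ := by linarith
    positivity
  have hk : ‖kap b n l‖ ≤ bm b (n - l) * min (knorm n) (knorm l) := by
    rw [mul_min_of_nonneg _ _ B]
    exact le_min (norm_kap_le' hb n l) (norm_kap_le b n l)
  have hz : kap b n l = 0 → ‖((knorm n ^ (2 * σ) - knorm l ^ (2 * σ) : ℝ) : ℂ) * kap b n l * f l‖ ≤
      (2 * σ * 4 ^ (2 * σ)) * (knorm n ^ σ * (bR σ b (n - l) * wR σ f l)) := by
    intro h
    rw [h]; simpa using R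
  by_cases hn : n = 0
  · apply hz
    rw [← norm_le_zero_iff]
    refine hk.trans ?_
    rw [hn, knorm_zero, min_eq_left l0, mul_zero]
  by_cases hl : l = 0
  · apply hz
    rw [← norm_le_zero_iff]
    refine hk.trans ?_
    rw [hl, knorm_zero, min_eq_right n0, mul_zero]
  by_cases hm : n - l = 0
  · apply hz
    rw [← norm_le_zero_iff]
    refine hk.trans ?_
    rw [hm, hbm0, zero_mul]
  have hd := knorm_diff (s := 2 * σ) (M := knorm n + knorm l) (by linarith) n l (by linarith)
    (by linarith)
  have p3 := pw3 hσ (one_le_knorm hn) (one_le_knorm hl) (one_le_knorm hm)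
    (by rw [knorm_sub_comm]; linarith [knorm_sub_le l n]) (by linarith [knorm_sub_le n l])
    (le_min n0 l0) (min_le_left _ _) (min_le_right _ _)
  rw [norm_mul, norm_mul, Complex.norm_real, Real.norm_eq_abs]
  have : 0 ≤ σ := by linarith
  calc _ ≤ (2 * σ * (knorm n + knorm l) ^ (2 * σ - 1) * knorm (n - l)) *
        (bm b (n - l) * min (knorm n) (knorm l)) * ‖f l‖ := by gcongr
    _ = (2 * σ * bm b (n - l) * ‖f l‖) *
        (knorm (n - l) * min (knorm n) (knorm l) * (knorm n + knorm l) ^ (2 * σ - 1)) := by ring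
    _ ≤ (2 * σ * bm b (n - l) * ‖f l‖) *
        (4 ^ (2 * σ) * (knorm n ^ σ * knorm l ^ σ * knorm (n - l) ^ σ)) := by gcongr
    _ = _ := by unfold bR wR; ring

lemma comm_bound {σ : ℝ} (hσ : 3 < σ) {b : Fin 3 → Z3 → ℂ} (hb : DivFree b) (hs : SmoothV3 b)
    (hb0 : ∀ j, b j 0 = 0) {f : Z3 → ℂ} (hf : L1W f) (n : Z3) :
    ‖commLam (2 * σ) b f n‖ₑ ≤ ENNReal.ofReal (2 * σ * 4 ^ (2 * σ)) *
      (ENNReal.ofReal (knorm n ^ σ) * cv (bE σ b) (wE σ f) n) := by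
  rw [commLam_eq (by linarith) hs hf]
  refine enorm_tsum_le_tsum_enorm.trans ?_
  unfold cv
  rw [← ENNReal.tsum_mul_left, ← ENNReal.tsum_mul_left]
  refine ENNReal.tsum_le_tsum fun l => ?_
  rw [← ofReal_norm]
  refine (ENNReal.ofReal_le_ofReal (comm_pt hσ hb hb0 f n l)).trans (le_of_eq ?_)
  have h0 : 0 ≤ 2 * σ * 4 ^ (2 * σ) := by have : 0 ≤ σ := by linarith
                                          positivity
  rw [ENNReal.ofReal_mul h0, ENNReal.ofReal_mul (Real.rpow_nonneg (knorm_nonneg n) _),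
    ENNReal.ofReal_mul (bR_nonneg _ _ _)]
  rfl

/-- divergence condition for the barotropic part -/
lemma div_of_hproj {V : Fin 2 → Z3 → ℂ} (hP : hproj V = V) (l : Z3) (hl : l 2 = 0) :
    (l 0 : ℂ) * V 0 l + (l 1 : ℂ) * V 1 l = 0 := by
  by_cases h : l 0 = 0 ∧ l 1 = 0
  · simp [h.1, h.2]
  have hd := den_ne h
  have h0 := congrFun (congrFun hP 0) l
  have h1 := congrFun (congrFun hP 1) l
  simp only [hproj, if_pos (And.intro hl h), sub_eq_self, div_eq_zero_iff, hd, or_false,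
    mul_eq_zero, Int.cast_eq_zero] at h0 h1
  simp only [Fin.castSucc_zero, Fin.castSucc_one] at h0 h1
  rcases h0 with h0 | h0
  · rcases h1 with h1 | h1
    · exact absurd ⟨h0, h1⟩ h
    · exact h1
  · exact h0

lemma knorm_sq (n : Z3) (h : n 2 = 0) :
    knorm n ^ 2 = (2 * Real.pi) ^ 2 * ((n 0 : ℝ) ^ 2 + (n 1 : ℝ) ^ 2) := by
  unfold knorm
  rw [mul_pow, Real.sq_sqrt (by positivity), Fin.sum_univ_three, h]
  simp

lemma q_pt {b : Fin 3 → Z3 → ℂ} (hb : DivFree b) {V : Fin 2 → Z3 → ℂ} (hP : hproj V = V)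
    (i : Fin 2) (n l : Z3) (hn2 : n 2 = 0) (h : ¬(n 0 = 0 ∧ n 1 = 0)) :
    ‖kap b n l * ((n i.castSucc : ℂ) * ((n 0 : ℂ) * V 0 l + (n 1 : ℂ) * V 1 l) /
      (((n 0 : ℂ)) ^ 2 + ((n 1 : ℂ)) ^ 2))‖ ≤
      (knorm (n - l) * bm b (n - l) + knorm n * aR b (n - l)) * vR V l := by
  have B := bm_nonneg b (n - l)
  have A := aR_nonneg b (n - l)
  have n0 := knorm_nonneg n
  have m0 := knorm_nonneg (n - l)
  have v0 := vR_nonneg V l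
  rw [norm_mul]
  by_cases hl : l 2 = 0
  · have hdiv := div_of_hproj hP l hl
    have e1 : (n 0 : ℂ) * V 0 l + (n 1 : ℂ) * V 1 l =
        (((n - l) 0 : ℤ) : ℂ) * V 0 l + (((n - l) 1 : ℤ) : ℂ) * V 1 l := by
      simp only [Pi.sub_apply]; push_cast
      linear_combination hdiv
    set q := (n i.castSucc : ℂ) * ((n 0 : ℂ) * V 0 l + (n 1 : ℂ) * V 1 l) /
      (((n 0 : ℂ)) ^ 2 + ((n 1 : ℂ)) ^ 2) with hq
    have hnpos : 0 < knorm n := by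
      have : n ≠ 0 := by rintro rfl; exact h ⟨rfl, rfl⟩
      linarith [one_le_knorm this]
    have hp : 0 < 2 * Real.pi := by positivity
    have hmv : 2 * Real.pi * ‖(n 0 : ℂ) * V 0 l + (n 1 : ℂ) * V 1 l‖ ≤ knorm (n - l) * vR V l := by
      rw [e1]
      have a0 := abs_comp_le (n - l) 0
      have a1 := abs_comp_le (n - l) 1
      rw [abs_mul, abs_of_pos hp] at a0 a1
      calc _ ≤ 2 * Real.pi * (|(((n - l) 0 : ℤ) : ℝ)| * ‖V 0 l‖ + |(((n - l) 1 : ℤ) : ℝ)| * ‖V 1 l‖) := by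
            gcongr
            refine (norm_add_le _ _).trans (le_of_eq ?_)
            rw [norm_mul, norm_mul, Complex.norm_intCast, Complex.norm_intCast]
        _ = (2 * Real.pi * |(((n - l) 0 : ℤ) : ℝ)|) * ‖V 0 l‖ +
            (2 * Real.pi * |(((n - l) 1 : ℤ) : ℝ)|) * ‖V 1 l‖ := by ring
        _ ≤ knorm (n - l) * ‖V 0 l‖ + knorm (n - l) * ‖V 1 l‖ := by gcongr
        _ = _ := by unfold vR; ring
    have hqe : ‖q‖ * knorm n ^ 2 = (2 * Real.pi * |(n i.castSucc : ℝ)|) *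
        (2 * Real.pi * ‖(n 0 : ℂ) * V 0 l + (n 1 : ℂ) * V 1 l‖) := by
      have hd := den_ne h
      have hden : ‖((n 0 : ℂ)) ^ 2 + ((n 1 : ℂ)) ^ 2‖ = (n 0 : ℝ) ^ 2 + (n 1 : ℝ) ^ 2 := by
        have e : (((n 0 : ℂ)) ^ 2 + ((n 1 : ℂ)) ^ 2) = (((n 0 : ℝ) ^ 2 + (n 1 : ℝ) ^ 2 : ℝ) : ℂ) := by
          push_cast; rfl
        rw [e, Complex.norm_real, Real.norm_of_nonneg (by positivity)]
      have hd' : (n 0 : ℝ) ^ 2 + (n 1 : ℝ) ^ 2 ≠ 0 := by rw [← hden]; simpa using hd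
      rw [hq, norm_div, norm_mul, Complex.norm_intCast, hden, knorm_sq n hn2]
      field_simp
    have ha := abs_comp_le n i.castSucc
    rw [abs_mul, abs_of_pos hp] at ha
    have hqn : knorm n * ‖q‖ ≤ knorm (n - l) * vR V l := by
      have : knorm n * (knorm n * ‖q‖) ≤ knorm n * (knorm (n - l) * vR V l) := by
        calc _ = ‖q‖ * knorm n ^ 2 := by ring
          _ ≤ _ := by rw [hqe]; gcongr
      exact le_of_mul_le_mul_left this hnpos
    calc _ ≤ bm b (n - l) * knorm n * ‖q‖ := by gcongr; exact norm_kap_le' hb n l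
      _ = bm b (n - l) * (knorm n * ‖q‖) := by ring
      _ ≤ bm b (n - l) * (knorm (n - l) * vR V l) := by gcongr
      _ ≤ _ := by nlinarith [mul_nonneg (mul_nonneg n0 A) v0]
  · have hm2 : (n - l) 2 ≠ 0 := by simp [hn2, hl]
    have hk : ‖kap b n l‖ ≤ knorm n * aR b (n - l) := by
      unfold kap
      rw [norm_mul, Complex.norm_I, one_mul, dotb_eq hb]
      unfold dotb aR
      rw [if_neg hm2, Fin.sum_univ_three, hn2]
      simp only [Int.cast_zero, mul_zero, Complex.ofReal_zero, add_zero]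
      refine (norm_add_le _ _).trans ?_
      rw [norm_mul, norm_mul, Complex.norm_real, Complex.norm_real, Real.norm_eq_abs,
        Real.norm_eq_abs, mul_add, mul_comm (knorm n), mul_comm (knorm n)]
      gcongr
      · exact abs_comp_le n 0
      · exact abs_comp_le n 1
    have hq := norm_q_le (fun i _ => V i l) i n h
    change _ ≤ vR V l at hq
    calc _ ≤ (knorm n * aR b (n - l)) * vR V l := by gcongr
      _ ≤ _ := by nlinarith [mul_nonneg (mul_nonneg m0 B) v0]

lemma q_bound {b : Fin 3 → Z3 → ℂ} (hb : DivFree b) (hs : SmoothV3 b) {V : Fin 2 → Z3 → ℂ}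
    (hV : ∀ i, L1W (V i)) (hP : hproj V = V) (i : Fin 2) (n : Z3) :
    ‖qproj (transportV b V) i n‖ₑ ≤
      ∑' l, ENNReal.ofReal ((knorm (n - l) * bm b (n - l) + knorm n * aR b (n - l)) * vR V l) := by
  by_cases h : n 2 = 0 ∧ ¬(n 0 = 0 ∧ n 1 = 0)
  · have s0 := kap_summable hs (hV 0) n
    have s1 := kap_summable hs (hV 1) n
    have e : qproj (transportV b V) i n = ∑' l, kap b n l * ((n i.castSucc : ℂ) *
        ((n 0 : ℂ) * V 0 l + (n 1 : ℂ) * V 1 l) / (((n 0 : ℂ)) ^ 2 + ((n 1 : ℂ)) ^ 2)) := by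
      simp only [qproj, hproj, Pi.sub_apply, if_pos h, sub_sub_cancel, transportV]
      rw [transport_eq hs (hV 0), transport_eq hs (hV 1), ← tsum_mul_left, ← tsum_mul_left,
        ← (s0.mul_left _).tsum_add (s1.mul_left _), ← tsum_mul_left, ← tsum_div_const]
      exact tsum_congr fun l => by ring
    rw [e]
    refine enorm_tsum_le_tsum_enorm.trans (ENNReal.tsum_le_tsum fun l => ?_)
    rw [← ofReal_norm]
    exact ENNReal.ofReal_le_ofReal (q_pt hb hP i n l h.1 h.2)
  · have : qproj (transportV b V) i n = 0 := by
      simp only [qproj, hproj, Pi.sub_apply, if_neg h, sub_self]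
    rw [this]; simp
end

section
open scoped BigOperators ENNReal
open Complex

lemma rpow_mono_k {m : Z3} (hm : m ≠ 0) {s t : ℝ} (h : s ≤ t) : knorm m ^ s ≤ knorm m ^ t :=
  Real.rpow_le_rpow_of_exponent_le (one_le_knorm hm) h

lemma bm_zero {b : Fin 3 → Z3 → ℂ} (hb0 : ∀ j, b j 0 = 0) : bm b 0 = 0 := by simp [bm, hb0]
lemma vR_zero {V : Fin 2 → Z3 → ℂ} (hV0 : ∀ i, V i 0 = 0) : vR V 0 = 0 := by simp [vR, hV0]
lemma aR_zero (b : Fin 3 → Z3 → ℂ) : aR b 0 = 0 := by simp [aR]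

lemma bR_mono {b : Fin 3 → Z3 → ℂ} (hb0 : ∀ j, b j 0 = 0) {s t : ℝ} (h : s ≤ t) (m : Z3) :
    bR s b m ≤ bR t b m := by
  unfold bR
  by_cases hm : m = 0
  · rw [hm, bm_zero hb0]; simp
  · have := bm_nonneg b m
    have := rpow_mono_k hm h
    gcongr

lemma T1 {σ : ℝ} (hσ : 3 < σ) {b : Fin 3 → Z3 → ℂ} (hb0 : ∀ j, b j 0 = 0) {V : Fin 2 → Z3 → ℂ}
    (hV0 : ∀ i, V i 0 = 0) (n l : Z3) :
    knorm n ^ σ * (knorm (n - l) * bm b (n - l) * vR V l) ≤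
      2 ^ σ * (bR (σ + 1) b (n - l) * (knorm l ^ σ * vR V l)) := by
  by_cases hl : l = 0
  · simp [hl, vR_zero hV0]
  by_cases hm : n - l = 0
  · simp [hm, bR, bm_zero hb0]
  have h1 := rpow_le_mul (s := σ) (by linarith) (one_le_knorm hm) (one_le_knorm hl) (knorm_nonneg n)
    (knorm_sub_le n l)
  have B := bm_nonneg b (n - l)
  have m0 := knorm_nonneg (n - l)
  have v0 := vR_nonneg V l
  have hmp : knorm (n - l) ^ (σ + 1) = knorm (n - l) ^ σ * knorm (n - l) := by
    rw [Real.rpow_add_one (by linarith [one_le_knorm hm])]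
  calc _ ≤ 2 ^ σ * (knorm (n - l) ^ σ * knorm l ^ σ) * (knorm (n - l) * bm b (n - l) * vR V l) := by
        gcongr
    _ = _ := by unfold bR; rw [hmp]; ring

lemma T2 {σ : ℝ} (hσ : 3 < σ) {b : Fin 3 → Z3 → ℂ} {V : Fin 2 → Z3 → ℂ}
    (hV0 : ∀ i, V i 0 = 0) (n l : Z3) :
    knorm n ^ (σ + 1 / 2) * (aR b (n - l) * vR V l) ≤
      2 ^ (σ + 1 / 2) * (bR (σ + 1) b (n - l) * (knorm l ^ σ * vR V l) +
        aR b (n - l) * (knorm l ^ (σ + 1 / 2) * vR V l)) := by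
  by_cases hl : l = 0
  · simp [hl, vR_zero hV0]
  have B := bm_nonneg b (n - l)
  have A := aR_nonneg b (n - l)
  have m0 := knorm_nonneg (n - l)
  have l0 := knorm_nonneg l
  have v0 := vR_nonneg V l
  by_cases hm : n - l = 0
  · rw [hm, aR_zero]
    have : 0 ≤ bR (σ + 1) b 0 := bR_nonneg _ _ _
    simp only [zero_mul, mul_zero, add_zero]
    positivity
  have h1 : knorm n ^ (σ + 1 / 2) ≤ 2 ^ (σ + 1 / 2) * (knorm (n - l) ^ (σ + 1 / 2) +
      knorm l ^ (σ + 1 / 2)) := by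
    refine le_trans ?_ (rpow_add_le' (by linarith) m0 l0)
    exact Real.rpow_le_rpow (knorm_nonneg n) (knorm_sub_le n l) (by linarith)
  have h2 : knorm (n - l) ^ (σ + 1 / 2) ≤ knorm (n - l) ^ (σ + 1) := rpow_mono_k hm (by linarith)
  have h3 : 1 ≤ knorm l ^ σ := Real.one_le_rpow (one_le_knorm hl) (by linarith)
  have h4 : knorm (n - l) ^ (σ + 1 / 2) * (aR b (n - l) * vR V l) ≤
      knorm (n - l) ^ (σ + 1) * bm b (n - l) * (knorm l ^ σ * vR V l) := by
    calc _ ≤ knorm (n - l) ^ (σ + 1) * (bm b (n - l) * (knorm l ^ σ * vR V l)) := by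
          gcongr
          · exact aR_le _ _
          · nlinarith
      _ = _ := by ring
  calc _ ≤ 2 ^ (σ + 1 / 2) * (knorm (n - l) ^ (σ + 1 / 2) +
      knorm l ^ (σ + 1 / 2)) * (aR b (n - l) * vR V l) := by gcongr
    _ = 2 ^ (σ + 1 / 2) * (knorm (n - l) ^ (σ + 1 / 2) * (aR b (n - l) * vR V l) +
      aR b (n - l) * (knorm l ^ (σ + 1 / 2) * vR V l)) := by ring
    _ ≤ _ := by unfold bR; gcongr

lemma T3 {σ : ℝ} {b : Fin 3 → Z3 → ℂ} (hb0 : ∀ j, b j 0 = 0) {V : Fin 2 → Z3 → ℂ}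
    (hV0 : ∀ i, V i 0 = 0) (n l : Z3) :
    knorm n ^ (1 / 2 : ℝ) * (bR σ b (n - l) * (knorm l ^ σ * vR V l)) ≤
      2 ^ (1 / 2 : ℝ) * (bR (σ + 1) b (n - l) * (knorm l ^ (σ + 1 / 2) * vR V l)) := by
  by_cases hl : l = 0
  · simp [hl, vR_zero hV0]
  by_cases hm : n - l = 0
  · simp [hm, bR, bm_zero hb0]
  have h1 := rpow_le_mul (s := 1 / 2) (by norm_num) (one_le_knorm hm) (one_le_knorm hl)
    (knorm_nonneg n) (knorm_sub_le n l)
  have B := bm_nonneg b (n - l)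
  have hm1 := one_le_knorm hm
  have hl1 := one_le_knorm hl
  have v0 := vR_nonneg V l
  have hlp : knorm l ^ (σ + 1 / 2) = knorm l ^ σ * knorm l ^ (1 / 2 : ℝ) :=
    Real.rpow_add (by linarith) _ _
  have hmp : knorm (n - l) ^ (σ + 1 / 2) = knorm (n - l) ^ σ * knorm (n - l) ^ (1 / 2 : ℝ) :=
    Real.rpow_add (by linarith) _ _
  have hmm : knorm (n - l) ^ (σ + 1 / 2) ≤ knorm (n - l) ^ (σ + 1) := rpow_mono_k hm (by linarith)
  have m0 := knorm_nonneg (n - l)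
  have l0 := knorm_nonneg l
  calc _ ≤ 2 ^ (1 / 2 : ℝ) * (knorm (n - l) ^ (1 / 2 : ℝ) * knorm l ^ (1 / 2 : ℝ)) *
        (bR σ b (n - l) * (knorm l ^ σ * vR V l)) := by
        have := bR_nonneg σ b (n - l)
        gcongr
    _ = 2 ^ (1 / 2 : ℝ) * ((knorm (n - l) ^ (σ + 1 / 2)) * bm b (n - l) *
        (knorm l ^ (σ + 1 / 2) * vR V l)) := by unfold bR; rw [hmp, hlp]; ring
    _ ≤ _ := by unfold bR; gcongr

lemma E_bound {σ : ℝ} (hσ : 3 < σ) {b : Fin 3 → Z3 → ℂ} (hb : DivFree b) (hs : SmoothV3 b)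
    (hb0 : ∀ j, b j 0 = 0) {V : Fin 2 → Z3 → ℂ} (hV : ∀ i, L1W (V i)) (hV0 : ∀ i, V i 0 = 0)
    (hP : hproj V = V) (i : Fin 2) :
    ‖ip (qproj (transportV b V) i) (commLam (2 * σ) b (V i))‖ₑ ≤
      ENNReal.ofReal (2 * σ * 4 ^ (2 * σ)) * (ENNReal.ofReal (2 ^ σ) *
        ((N1 (bE (σ + 1) b) * N2 (wV σ V)) * (N1 (bE (σ + 1) b) * N2 (wV σ V))) +
        ENNReal.ofReal (2 ^ (σ + 1 / 2)) * ENNReal.ofReal (2 ^ (1 / 2 : ℝ)) *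
        ((N1 (bE (σ + 1) b) * N2 (wV σ V)) * (N1 (bE (σ + 1) b) * N2 (wV (σ + 1 / 2) V)) +
         (N1 (aE b) * N2 (wV (σ + 1 / 2) V)) * (N1 (bE (σ + 1) b) * N2 (wV (σ + 1 / 2) V)))) := by
  set K := ENNReal.ofReal (2 * σ * 4 ^ (2 * σ))
  set k1 := ENNReal.ofReal (2 ^ σ) with hk1
  set k2 := ENNReal.ofReal (2 ^ (σ + 1 / 2)) with hk2
  set k3 := ENNReal.ofReal (2 ^ (1 / 2 : ℝ)) with hk3
  set β := bE (σ + 1) b with hβ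
  set w := wV σ V with hw
  set w' := wV (σ + 1 / 2) V with hw'
  set P := cv (bE σ b) w with hPdef
  have hPle : ∀ n, P n ≤ cv β w n := fun n => cv_mono
    (fun m => ENNReal.ofReal_le_ofReal (bR_mono hb0 (by linarith) m)) (fun _ => le_rfl) n
  have pt : ∀ n, ‖qproj (transportV b V) i n‖ₑ * ‖commLam (2 * σ) b (V i) n‖ₑ ≤
      K * (k1 * (cv β w n * cv β w n) + k2 * k3 * (cv β w n * cv β w' n + cv (aE b) w' n * cv β w' n)) := by
    intro n
    have n0 := knorm_nonneg n
    have hq := q_bound hb hs hV hP i n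
    have hc := comm_bound hσ hb hs hb0 (hV i) n
    have hc' : ‖commLam (2 * σ) b (V i) n‖ₑ ≤ K * (ENNReal.ofReal (knorm n ^ σ) * P n) := by
      refine hc.trans ?_
      gcongr
      exact cv_mono (fun _ => le_rfl) (wE_le_wV σ V i) n
    set Q1 := ∑' l, ENNReal.ofReal (knorm (n - l) * bm b (n - l) * vR V l) with hQ1
    set Q2 := ∑' l, ENNReal.ofReal (aR b (n - l) * vR V l) with hQ2
    have hq' : ‖qproj (transportV b V) i n‖ₑ ≤ Q1 + ENNReal.ofReal (knorm n) * Q2 := by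
      refine hq.trans (le_of_eq ?_)
      rw [hQ1, hQ2, ← ENNReal.tsum_mul_left, ← ENNReal.tsum_add]
      refine tsum_congr fun l => ?_
      have := vR_nonneg V l
      have := aR_nonneg b (n - l)
      have := bm_nonneg b (n - l)
      have := knorm_nonneg (n - l)
      rw [← ENNReal.ofReal_mul n0, ← ENNReal.ofReal_add (by positivity) (by positivity)]
      congr 1; ring
    have g1 : ENNReal.ofReal (knorm n ^ σ) * Q1 ≤ k1 * cv β w n := by
      unfold cv
      rw [hQ1, ← ENNReal.tsum_mul_left, ← ENNReal.tsum_mul_left]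
      refine ENNReal.tsum_le_tsum fun l => ?_
      rw [hβ, hw, bE, wV, ← ENNReal.ofReal_mul (bR_nonneg _ _ _), hk1,
        ← ENNReal.ofReal_mul (by positivity), ← ENNReal.ofReal_mul (by positivity)]
      exact ENNReal.ofReal_le_ofReal (T1 hσ hb0 hV0 n l)
    have g2 : ENNReal.ofReal (knorm n ^ (σ + 1 / 2)) * Q2 ≤ k2 * (cv β w n + cv (aE b) w' n) := by
      unfold cv
      rw [hQ2, ← ENNReal.tsum_add, ← ENNReal.tsum_mul_left, ← ENNReal.tsum_mul_left]
      refine ENNReal.tsum_le_tsum fun l => ?_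
      have := vR_nonneg V l
      have := aR_nonneg b (n - l)
      have := bR_nonneg (σ + 1) b (n - l)
      have := knorm_nonneg l
      rw [hβ, hw, hw', bE, wV, aE, wV, ← ENNReal.ofReal_mul (bR_nonneg _ _ _), hk2,
        ← ENNReal.ofReal_mul (aR_nonneg _ _), ← ENNReal.ofReal_add (by positivity) (by positivity),
        ← ENNReal.ofReal_mul (by positivity), ← ENNReal.ofReal_mul (by positivity)]
      exact ENNReal.ofReal_le_ofReal (T2 hσ hV0 n l)
    have g3 : ENNReal.ofReal (knorm n ^ (1 / 2 : ℝ)) * P n ≤ k3 * cv β w' n := by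
      rw [hPdef]
      unfold cv
      rw [← ENNReal.tsum_mul_left, ← ENNReal.tsum_mul_left]
      refine ENNReal.tsum_le_tsum fun l => ?_
      rw [hβ, hw, hw', bE, bE, wV, wV, ← ENNReal.ofReal_mul (bR_nonneg _ _ _), hk3,
        ← ENNReal.ofReal_mul (bR_nonneg _ _ _),
        ← ENNReal.ofReal_mul (by positivity), ← ENNReal.ofReal_mul (by positivity)]
      exact ENNReal.ofReal_le_ofReal (T3 hb0 hV0 n l)
    have hsplit : ENNReal.ofReal (knorm n) * ENNReal.ofReal (knorm n ^ σ) =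
        ENNReal.ofReal (knorm n ^ (σ + 1 / 2)) * ENNReal.ofReal (knorm n ^ (1 / 2 : ℝ)) := by
      rw [← ENNReal.ofReal_mul n0, ← ENNReal.ofReal_mul (by positivity)]
      congr 1
      rw [← Real.rpow_add_of_nonneg n0 (by linarith) (by norm_num),
        show σ + 1 / 2 + 1 / 2 = 1 + σ by ring,
        Real.rpow_add_of_nonneg n0 (by norm_num) (by linarith), Real.rpow_one]
    calc _ ≤ (Q1 + ENNReal.ofReal (knorm n) * Q2) * (K * (ENNReal.ofReal (knorm n ^ σ) * P n)) := by
          gcongr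
      _ = K * ((ENNReal.ofReal (knorm n ^ σ) * Q1) * P n +
          (ENNReal.ofReal (knorm n) * ENNReal.ofReal (knorm n ^ σ)) * Q2 * P n) := by ring
      _ = K * ((ENNReal.ofReal (knorm n ^ σ) * Q1) * P n +
          (ENNReal.ofReal (knorm n ^ (σ + 1 / 2)) * Q2) *
            (ENNReal.ofReal (knorm n ^ (1 / 2 : ℝ)) * P n)) := by rw [hsplit]; ring
      _ ≤ K * ((k1 * cv β w n) * cv β w n + (k2 * (cv β w n + cv (aE b) w' n)) * (k3 * cv β w' n)) := by
          gcongr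
          exact hPle n
      _ = _ := by ring
  unfold ip
  refine enorm_tsum_le_tsum_enorm.trans ?_
  simp_rw [enorm_mul, RCLike.enorm_conj]
  refine (ENNReal.tsum_le_tsum pt).trans ?_
  rw [ENNReal.tsum_mul_left, ENNReal.tsum_add, ENNReal.tsum_mul_left, ENNReal.tsum_mul_left,
    ENNReal.tsum_add]
  gcongr <;> exact cvcv _ _ _ _
end

section
open scoped BigOperators ENNReal
open Complex

lemma hnorm_nonneg (t : ℝ) (c : Z3 → ℂ) : 0 ≤ hnorm t c := Real.sqrt_nonneg _

lemma hterm_nonneg (t : ℝ) (c : Z3 → ℂ) (n : Z3) : 0 ≤ (1 + knorm n ^ (2 * t)) * ‖c n‖ ^ 2 := by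
  have := Real.rpow_nonneg (knorm_nonneg n) (2 * t)
  positivity

lemma hsum_ne_top {t : ℝ} (ht : 0 ≤ t) {c : Z3 → ℂ} (hc : L1W c) :
    ∑' n, ENNReal.ofReal ((1 + knorm n ^ (2 * t)) * ‖c n‖ ^ 2) ≠ ⊤ := by
  have hle : ∀ n, ENNReal.ofReal ((1 + knorm n ^ (2 * t)) * ‖c n‖ ^ 2) ≤
      (∑' k, ‖c k‖ₑ) * (‖c n‖ₑ + ‖c n‖ₑ * jw n ^ ⌈2 * t⌉₊) := by
    intro n
    have k0 := Real.rpow_nonneg (knorm_nonneg n) (2 * t)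
    rw [ENNReal.ofReal_mul (by positivity), ENNReal.ofReal_add (by norm_num) k0,
      ENNReal.ofReal_pow (norm_nonneg _), ofReal_norm, ENNReal.ofReal_one, sq]
    calc (1 + ENNReal.ofReal (knorm n ^ (2 * t))) * (‖c n‖ₑ * ‖c n‖ₑ)
        ≤ (1 + jw n ^ ⌈2 * t⌉₊) * ((∑' k, ‖c k‖ₑ) * ‖c n‖ₑ) := by
          gcongr
          · exact knorm_rpow_le_jw (by linarith) n
          · exact ENNReal.le_tsum (f := fun k => ‖c k‖ₑ) n
      _ = _ := by ring
  refine ne_top_of_le_ne_top ?_ (ENNReal.tsum_le_tsum hle)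
  rw [ENNReal.tsum_mul_left, ENNReal.tsum_add]
  exact ENNReal.mul_ne_top hc.tsum_ne_top (ENNReal.add_ne_top.mpr ⟨hc.tsum_ne_top, hc _⟩)

lemma hsum_eq {t : ℝ} (ht : 0 ≤ t) {c : Z3 → ℂ} (hc : L1W c) :
    ∑' n, ENNReal.ofReal ((1 + knorm n ^ (2 * t)) * ‖c n‖ ^ 2) = ENNReal.ofReal (hnorm t c) ^ 2 := by
  have h0 := hterm_nonneg t c
  have hsum : Summable fun n => (1 + knorm n ^ (2 * t)) * ‖c n‖ ^ 2 := by
    have := ENNReal.summable_toReal (hsum_ne_top ht hc)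
    refine this.congr fun n => ?_
    rw [ENNReal.toReal_ofReal (h0 n)]
  rw [← ENNReal.ofReal_tsum_of_nonneg h0 hsum, ← ENNReal.ofReal_pow (hnorm_nonneg _ _)]
  unfold hnorm
  rw [Real.sq_sqrt (tsum_nonneg h0)]

lemma wR_sq_le (s : ℝ) (c : Z3 → ℂ) (n : Z3) : wR s c n ^ 2 ≤ (1 + knorm n ^ (2 * s)) * ‖c n‖ ^ 2 := by
  unfold wR
  have : (knorm n ^ s) ^ 2 = knorm n ^ (2 * s) := by
    rw [← Real.rpow_natCast, ← Real.rpow_mul (knorm_nonneg n)]; congr 1; push_cast; ring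
  rw [mul_pow, this]
  gcongr
  linarith

lemma N2_wE_le {t : ℝ} (ht : 0 ≤ t) {c : Z3 → ℂ} (hc : L1W c) :
    N2 (wE t c) ≤ ENNReal.ofReal (hnorm t c) := by
  apply le_of_sq_le'
  rw [N2_sq, ← hsum_eq ht hc]
  refine ENNReal.tsum_le_tsum fun n => ?_
  unfold wE
  rw [← ENNReal.ofReal_pow (wR_nonneg _ _ _)]
  exact ENNReal.ofReal_le_ofReal (wR_sq_le t c n)

lemma hnorm_le_V2 (t : ℝ) (V : Fin 2 → Z3 → ℂ) (i : Fin 2) : hnorm t (V i) ≤ hnormV2 t V := by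
  unfold hnormV2
  apply Real.le_sqrt_of_sq_le
  exact Finset.single_le_sum (f := fun i => hnorm t (V i) ^ 2) (fun _ _ => sq_nonneg _) (Finset.mem_univ i)

lemma hnorm_le_V3 (t : ℝ) (V : Fin 3 → Z3 → ℂ) (i : Fin 3) : hnorm t (V i) ≤ hnormV3 t V := by
  unfold hnormV3
  apply Real.le_sqrt_of_sq_le
  exact Finset.single_le_sum (f := fun i => hnorm t (V i) ^ 2) (fun _ _ => sq_nonneg _) (Finset.mem_univ i)

lemma wV_eq (s : ℝ) (V : Fin 2 → Z3 → ℂ) (n : Z3) : wV s V n = wE s (V 0) n + wE s (V 1) n := by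
  unfold wV wE vR
  rw [← ENNReal.ofReal_add (wR_nonneg _ _ _) (wR_nonneg _ _ _)]
  congr 1
  unfold wR; ring

lemma N2_mono {F G : Z3 → ℝ≥0∞} (h : ∀ n, F n ≤ G n) : N2 F ≤ N2 G := by
  unfold N2
  apply ENNReal.rpow_le_rpow _ (by norm_num)
  exact ENNReal.tsum_le_tsum fun n => by gcongr; exact h n

lemma N2_wV_le {t : ℝ} (ht : 0 ≤ t) {V : Fin 2 → Z3 → ℂ} (hV : ∀ i, L1W (V i)) :
    N2 (wV t V) ≤ 2 * ENNReal.ofReal (hnormV2 t V) := by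
  have hi : ∀ i, N2 (wE t (V i)) ≤ ENNReal.ofReal (hnormV2 t V) := fun i =>
    (N2_wE_le ht (hV i)).trans (ENNReal.ofReal_le_ofReal (hnorm_le_V2 t V i))
  apply le_of_sq_le'
  rw [N2_sq]
  calc ∑' n, wV t V n ^ 2 ≤ ∑' n, (2 * wE t (V 0) n ^ 2 + 2 * wE t (V 1) n ^ 2) := by
        refine ENNReal.tsum_le_tsum fun n => ?_
        rw [wV_eq]
        calc (wE t (V 0) n + wE t (V 1) n) ^ 2 = wE t (V 0) n ^ 2 + wE t (V 1) n ^ 2 +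
              2 * (wE t (V 0) n * wE t (V 1) n) := by ring
          _ ≤ wE t (V 0) n ^ 2 + wE t (V 1) n ^ 2 + (wE t (V 0) n ^ 2 + wE t (V 1) n ^ 2) := by
              gcongr; exact ennreal_two_mul_le _ _
          _ = _ := by ring
    _ = 2 * N2 (wE t (V 0)) ^ 2 + 2 * N2 (wE t (V 1)) ^ 2 := by
        rw [ENNReal.tsum_add, ENNReal.tsum_mul_left, ENNReal.tsum_mul_left, N2_sq, N2_sq]
    _ ≤ 2 * ENNReal.ofReal (hnormV2 t V) ^ 2 + 2 * ENNReal.ofReal (hnormV2 t V) ^ 2 := by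
        gcongr
        · exact hi 0
        · exact hi 1
    _ = _ := by ring

def ZN (r : ℝ) : ℝ≥0∞ := N2 (fun n => ENNReal.ofReal (knorm n ^ (-r)))

lemma ZN_ne_top {r : ℝ} (hr : 3 < 2 * r) : ZN r ≠ ⊤ := by
  unfold ZN N2
  apply ENNReal.rpow_ne_top_of_nonneg (by norm_num)
  have e : ∀ n : Z3, ENNReal.ofReal (knorm n ^ (-r)) ^ 2 = ENNReal.ofReal (knorm n ^ (-(2 * r))) := by
    intro n
    rw [← ENNReal.ofReal_pow (Real.rpow_nonneg (knorm_nonneg n) _), ← Real.rpow_natCast,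
      ← Real.rpow_mul (knorm_nonneg n)]
    congr 2; push_cast; ring
  simp_rw [e]
  exact (summable_knorm hr).tsum_ofReal_ne_top

lemma N1_wE_le {s r : ℝ} (h : 0 ≤ s + r) {c : Z3 → ℂ} (hc : L1W c) (hc0 : c 0 = 0) :
    N1 (wE s c) ≤ ZN r * ENNReal.ofReal (hnorm (s + r) c) := by
  calc N1 (wE s c) = ∑' n, ENNReal.ofReal (knorm n ^ (-r)) * wE (s + r) c n := by
        unfold N1
        refine tsum_congr fun n => ?_
        unfold wE
        rw [← ENNReal.ofReal_mul (Real.rpow_nonneg (knorm_nonneg n) _)]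
        congr 1
        unfold wR
        by_cases hn : n = 0
        · simp [hn, hc0]
        · rw [← mul_assoc, ← Real.rpow_add (by linarith [one_le_knorm hn])]
          congr 2; ring
    _ ≤ ZN r * N2 (wE (s + r) c) := holder _ _
    _ ≤ _ := by gcongr; exact N2_wE_le h hc

lemma N1_bE_le {σ : ℝ} (hσ : 3 < σ) {b : Fin 3 → Z3 → ℂ} (hs : SmoothV3 b) (hb0 : ∀ j, b j 0 = 0) :
    N1 (bE (σ + 1) b) ≤ 3 * ZN 2 * ENNReal.ofReal (hnormV3 (σ + 3) b) := by
  have e : N1 (bE (σ + 1) b) = ∑ j, N1 (wE (σ + 1) (b j)) := by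
    unfold N1
    rw [← Summable.tsum_finsetSum fun _ _ => ENNReal.summable]
    refine tsum_congr fun n => ?_
    unfold bE wE bR bm
    rw [Finset.mul_sum]
    exact ENNReal.ofReal_sum_of_nonneg fun j _ => wR_nonneg (σ + 1) (b j) n
  rw [e]
  calc _ ≤ ∑ _j : Fin 3, ZN 2 * ENNReal.ofReal (hnormV3 (σ + 3) b) := by
        refine Finset.sum_le_sum fun j _ => ?_
        refine (N1_wE_le (s := σ + 1) (r := 2) (by linarith) (hs j).2.l1w (hb0 j)).trans ?_
        gcongr
        rw [show σ + 1 + 2 = σ + 3 by ring]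
        exact hnorm_le_V3 _ _ _
    _ = _ := by simp; ring

lemma L1W.dzbh {b : Fin 3 → Z3 → ℂ} (hs : SmoothV3 b) (i : Fin 2) : L1W (dzbh b i) := by
  refine L1W.mono (F := fun n => ‖b i.castSucc n‖ₑ * jw n) (fun N => ?_) (fun n => ?_)
  · have := (hs i.castSucc).2.l1w (N + 1)
    simpa only [pow_succ', mul_assoc] using this
  · unfold _root_.dzbh pd jw
    rw [enorm_mul, mul_comm]
    gcongr
    rw [← ofReal_norm, norm_mul, Complex.norm_I, one_mul, Complex.norm_real, Real.norm_eq_abs]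
    apply ENNReal.ofReal_le_ofReal
    linarith [abs_comp_le n 2]

lemma N1_aE_le {σ : ℝ} (hσ : 3 < σ) {b : Fin 3 → Z3 → ℂ} (hs : SmoothV3 b) :
    N1 (aE b) ≤ 2 * ZN (σ - 3 / 2) * ENNReal.ofReal (hnormV2 (σ - 3 / 2) (dzbh b)) := by
  have hi : ∀ i, N1 (wE 0 (dzbh b i)) ≤
      ZN (σ - 3 / 2) * ENNReal.ofReal (hnormV2 (σ - 3 / 2) (dzbh b)) := by
    intro i
    have h := N1_wE_le (s := 0) (r := σ - 3 / 2) (by linarith) (L1W.dzbh hs i)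
      (by simp [dzbh, pd])
    rw [zero_add] at h
    refine h.trans ?_
    gcongr
    exact hnorm_le_V2 _ _ _
  calc N1 (aE b) ≤ N1 (wE 0 (dzbh b 0)) + N1 (wE 0 (dzbh b 1)) := by
        unfold N1
        rw [← ENNReal.tsum_add]
        refine ENNReal.tsum_le_tsum fun m => ?_
        unfold aE wE
        rw [← ENNReal.ofReal_add (wR_nonneg _ _ _) (wR_nonneg _ _ _)]
        apply ENNReal.ofReal_le_ofReal
        unfold aR
        split_ifs with h
        · exact add_nonneg (wR_nonneg _ _ _) (wR_nonneg _ _ _)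
        · have key : ∀ i : Fin 2, ‖b i.castSucc m‖ ≤ wR 0 (dzbh b i) m := by
            intro i
            unfold wR dzbh pd
            rw [Real.rpow_zero, one_mul, norm_mul, norm_mul, Complex.norm_I, one_mul,
              Complex.norm_real, Real.norm_eq_abs, abs_mul]
            have h1 : (1 : ℝ) ≤ |(m 2 : ℝ)| := by
              have := Int.one_le_abs h
              exact_mod_cast this
            have h2 := two_pi_ge_one
            rw [abs_of_nonneg (by linarith : (0 : ℝ) ≤ 2 * Real.pi)]
            have h3 : 1 ≤ 2 * Real.pi * |(m 2 : ℝ)| := one_le_mul_of_one_le_of_one_le h2 h1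
            nlinarith [norm_nonneg (b i.castSucc m)]
          exact add_le_add (key 0) (key 1)
    _ ≤ _ := (add_le_add (hi 0) (hi 1)).trans (le_of_eq (by ring))
end

section
open scoped BigOperators ENNReal
open Complex

/-- the final constant -/
def CT (σ : ℝ) : ℝ≥0∞ :=
  2 * (ENNReal.ofReal (CH σ) * (3 * ZN 2 * 2 * (3 * ZN 2 * 2)) +
    ENNReal.ofReal (2 * σ * 4 ^ (2 * σ)) * (ENNReal.ofReal (2 ^ σ) * (3 * ZN 2 * 2 * (3 * ZN 2 * 2)) +
      ENNReal.ofReal (2 ^ (σ + 1 / 2)) * ENNReal.ofReal (2 ^ (1 / 2 : ℝ)) *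
        (3 * ZN 2 * 2 * (3 * ZN 2 * 2) + 2 * ZN (σ - 3 / 2) * 2 * (3 * ZN 2 * 2))))

lemma CT_ne_top {σ : ℝ} (hσ : 3 < σ) : CT σ ≠ ⊤ := by
  have h1 := ZN_ne_top (r := 2) (by norm_num)
  have h2 := ZN_ne_top (r := σ - 3 / 2) (by linarith)
  unfold CT
  finiteness

lemma ofReal_qty {σ : ℝ} (hσ : 3 < σ) {b : Fin 3 → Z3 → ℂ} (hs : SmoothV3 b) (hb : DivFree b)
    (hb0 : ∀ j, b j 0 = 0) {V : Fin 2 → Z3 → ℂ} (hV : ∀ i, L1W (V i)) (hV0 : ∀ i, V i 0 = 0)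
    (hP : hproj V = V) :
    ENNReal.ofReal (inner2V (PB b (PB b V)) (lamV (2 * σ) V) + (l2normV (lamV σ (PB b V))) ^ 2) ≤
      CT σ * ENNReal.ofReal (hnormV3 (σ + 3) b * hnormV2 (σ - 3 / 2) (dzbh b) * hnormV2 (σ + 1 / 2) V ^ 2 +
                 hnormV3 (σ + 3) b ^ 2 * hnormV2 σ V * hnormV2 (σ + 1 / 2) V +
                 hnormV3 (σ + 3) b ^ 2 * hnormV2 σ V ^ 2) := by
  rw [qty_eq (by linarith) hs hb hV hP]
  have B0 : 0 ≤ hnormV3 (σ + 3) b := Real.sqrt_nonneg _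
  have A0 : 0 ≤ hnormV2 (σ - 3 / 2) (dzbh b) := Real.sqrt_nonneg _
  have W0 : 0 ≤ hnormV2 σ V := Real.sqrt_nonneg _
  have W0' : 0 ≤ hnormV2 (σ + 1 / 2) V := Real.sqrt_nonneg _
  have hβ := N1_bE_le hσ hs hb0
  have ha := N1_aE_le hσ hs
  have hw := N2_wV_le (t := σ) (by linarith) hV
  have hw' := N2_wV_le (t := σ + 1 / 2) (by linarith) hV
  have hX : ∀ i, ENNReal.ofReal (ip (transport b (V i)) (commLam (2 * σ) b (V i))).re ≤
      ENNReal.ofReal (CH σ) * ((N1 (bE (σ + 1) b) * N2 (wV σ V)) * (N1 (bE (σ + 1) b) * N2 (wV σ V))) := by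
    intro i
    have h := main_term hσ hb hs hb0 (hV i) (hV0 i)
    refine le_trans ?_ (h.trans ?_)
    · rcases le_total 0 (ip (transport b (V i)) (commLam (2 * σ) b (V i))).re with h0 | h0
      · exact ENNReal.ofReal_le_ofReal (by linarith)
      · rw [ENNReal.ofReal_of_nonpos h0]; exact zero_le
    · have := N2_mono (wE_le_wV σ V i)
      gcongr
  have hE := E_bound hσ hb hs hb0 hV hV0 hP
  have hle : (∑ i, ip (transport b (V i)) (commLam (2 * σ) b (V i))).re -
      (∑ i, ip (qproj (transportV b V) i) (commLam (2 * σ) b (V i))).re ≤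
      ((ip (transport b (V 0)) (commLam (2 * σ) b (V 0))).re +
       (ip (transport b (V 1)) (commLam (2 * σ) b (V 1))).re) +
      (‖ip (qproj (transportV b V) 0) (commLam (2 * σ) b (V 0))‖ +
       ‖ip (qproj (transportV b V) 1) (commLam (2 * σ) b (V 1))‖) := by
    have h0 := Complex.abs_re_le_norm (ip (qproj (transportV b V) 0) (commLam (2 * σ) b (V 0)))
    have h1 := Complex.abs_re_le_norm (ip (qproj (transportV b V) 1) (commLam (2 * σ) b (V 1)))
    rw [Fin.sum_univ_two, Fin.sum_univ_two, Complex.add_re, Complex.add_re]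
    linarith [(abs_le.mp h0).1, (abs_le.mp h1).1]
  refine (ENNReal.ofReal_le_ofReal hle).trans ?_
  refine ENNReal.ofReal_add_le.trans ?_
  refine (add_le_add ENNReal.ofReal_add_le ENNReal.ofReal_add_le).trans ?_
  rw [ofReal_norm, ofReal_norm]
  refine (add_le_add (add_le_add (hX 0) (hX 1)) (add_le_add (hE 0) (hE 1))).trans ?_
  have hTeq : ∀ B A W W' : ℝ, 0 ≤ B → 0 ≤ A → 0 ≤ W → 0 ≤ W' →
      ENNReal.ofReal (B * A * W' ^ 2 + B ^ 2 * W * W' + B ^ 2 * W ^ 2) =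
      ENNReal.ofReal B * ENNReal.ofReal A * ENNReal.ofReal W' ^ 2 +
      ENNReal.ofReal B ^ 2 * ENNReal.ofReal W * ENNReal.ofReal W' +
      ENNReal.ofReal B ^ 2 * ENNReal.ofReal W ^ 2 := by
    intro B A W W' hB hA hW hW'
    have p1 : 0 ≤ B * A * W' ^ 2 := by positivity
    have p2 : 0 ≤ B ^ 2 * W * W' := by positivity
    have p3 : 0 ≤ B ^ 2 * W ^ 2 := by positivity
    rw [ENNReal.ofReal_add (add_nonneg p1 p2) p3, ENNReal.ofReal_add p1 p2,
      ENNReal.ofReal_mul (p := B * A) (mul_nonneg hB hA), ENNReal.ofReal_mul (p := B) hB,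
      ENNReal.ofReal_mul (p := B ^ 2 * W) (mul_nonneg (pow_nonneg hB 2) hW),
      ENNReal.ofReal_mul (p := B ^ 2) (q := W) (pow_nonneg hB 2),
      ENNReal.ofReal_mul (p := B ^ 2) (q := W ^ 2) (pow_nonneg hB 2),
      ENNReal.ofReal_pow hB, ENNReal.ofReal_pow hW, ENNReal.ofReal_pow hW']
  rw [hTeq _ _ _ _ B0 A0 W0 W0']
  set B := ENNReal.ofReal (hnormV3 (σ + 3) b)
  set A := ENNReal.ofReal (hnormV2 (σ - 3 / 2) (dzbh b))
  set W := ENNReal.ofReal (hnormV2 σ V)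
  set W' := ENNReal.ofReal (hnormV2 (σ + 1 / 2) V)
  unfold CT
  set k0 := ENNReal.ofReal (CH σ)
  set K := ENNReal.ofReal (2 * σ * 4 ^ (2 * σ))
  set k1 := ENNReal.ofReal (2 ^ σ)
  set k2 := ENNReal.ofReal (2 ^ (σ + 1 / 2))
  set k3 := ENNReal.ofReal (2 ^ (1 / 2 : ℝ))
  set z := ZN 2
  set y := ZN (σ - 3 / 2)
  set T := B * A * W' ^ 2 + B ^ 2 * W * W' + B ^ 2 * W ^ 2 with hT
  have t1 : B ^ 2 * W ^ 2 ≤ T := le_add_self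
  have t2 : B ^ 2 * W * W' ≤ T := le_add_right le_add_self
  have t3 : B * A * W' ^ 2 ≤ T := le_add_right (le_add_right le_rfl)
  have bb : N1 (bE (σ + 1) b) * N2 (wV σ V) ≤ (3 * z * 2) * (B * W) :=
    (mul_le_mul' hβ hw).trans (le_of_eq (by ring))
  have bb' : N1 (bE (σ + 1) b) * N2 (wV (σ + 1 / 2) V) ≤ (3 * z * 2) * (B * W') :=
    (mul_le_mul' hβ hw').trans (le_of_eq (by ring))
  have aa' : N1 (aE b) * N2 (wV (σ + 1 / 2) V) ≤ (2 * y * 2) * (A * W') :=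
    (mul_le_mul' ha hw').trans (le_of_eq (by ring))
  have u1 : (N1 (bE (σ + 1) b) * N2 (wV σ V)) * (N1 (bE (σ + 1) b) * N2 (wV σ V)) ≤
      (3 * z * 2 * (3 * z * 2)) * T := by
    refine (mul_le_mul' bb bb).trans ?_
    calc _ = (3 * z * 2 * (3 * z * 2)) * (B ^ 2 * W ^ 2) := by ring
      _ ≤ _ := by gcongr
  have u2 : (N1 (bE (σ + 1) b) * N2 (wV σ V)) * (N1 (bE (σ + 1) b) * N2 (wV (σ + 1 / 2) V)) ≤
      (3 * z * 2 * (3 * z * 2)) * T := by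
    refine (mul_le_mul' bb bb').trans ?_
    calc _ = (3 * z * 2 * (3 * z * 2)) * (B ^ 2 * W * W') := by ring
      _ ≤ _ := by gcongr
  have u3 : (N1 (aE b) * N2 (wV (σ + 1 / 2) V)) * (N1 (bE (σ + 1) b) * N2 (wV (σ + 1 / 2) V)) ≤
      (2 * y * 2 * (3 * z * 2)) * T := by
    refine (mul_le_mul' aa' bb').trans ?_
    calc _ = (2 * y * 2 * (3 * z * 2)) * (B * A * W' ^ 2) := by ring
      _ ≤ _ := by gcongr
  have step : ∀ x1 x2 x3 c1 c2 : ℝ≥0∞, x1 ≤ c1 * T → x2 ≤ c1 * T → x3 ≤ c2 * T →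
      k0 * x1 + k0 * x1 + (K * (k1 * x1 + k2 * k3 * (x2 + x3)) + K * (k1 * x1 + k2 * k3 * (x2 + x3))) ≤
      2 * (k0 * c1 + K * (k1 * c1 + k2 * k3 * (c1 + c2))) * T := by
    intro x1 x2 x3 c1 c2 h1 h2 h3
    calc _ ≤ k0 * (c1 * T) + k0 * (c1 * T) + (K * (k1 * (c1 * T) + k2 * k3 * ((c1 * T) + (c2 * T))) +
          K * (k1 * (c1 * T) + k2 * k3 * ((c1 * T) + (c2 * T)))) := by gcongr
      _ = _ := by ring
  exact step _ _ _ _ _ u1 u2 u3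

theorem main5 (σ : ℝ) (hσ : 3 < σ) :
    ∃ C : ℝ, 0 < C ∧
      ∀ b : Fin 3 → Z3 → ℂ, SmoothV3 b → DivFree b → (∀ j, ZeroMean (b j)) →
        ∀ V : Fin 2 → Z3 → ℂ, SmoothV2 V → (∀ i, ZeroMean (V i)) → hproj V = V →
          inner2V (PB b (PB b V)) (lamV (2 * σ) V) + (l2normV (lamV σ (PB b V))) ^ 2 ≤
            C * (hnormV3 (σ + 3) b * hnormV2 (σ - 3 / 2) (dzbh b) * hnormV2 (σ + 1 / 2) V ^ 2 +
                 hnormV3 (σ + 3) b ^ 2 * hnormV2 σ V * hnormV2 (σ + 1 / 2) V +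
                 hnormV3 (σ + 3) b ^ 2 * hnormV2 σ V ^ 2) := by
  refine ⟨(CT σ).toReal + 1, by positivity, ?_⟩
  intro b hs hb hb0 V hV hV0 hP
  have h := ofReal_qty hσ hs hb hb0 (fun i => (hV i).2.l1w) hV0 hP
  have B0 : 0 ≤ hnormV3 (σ + 3) b := Real.sqrt_nonneg _
  have A0 : 0 ≤ hnormV2 (σ - 3 / 2) (dzbh b) := Real.sqrt_nonneg _
  have W0 : 0 ≤ hnormV2 σ V := Real.sqrt_nonneg _
  have W0' : 0 ≤ hnormV2 (σ + 1 / 2) V := Real.sqrt_nonneg _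
  have T0 : 0 ≤ hnormV3 (σ + 3) b * hnormV2 (σ - 3 / 2) (dzbh b) * hnormV2 (σ + 1 / 2) V ^ 2 +
                 hnormV3 (σ + 3) b ^ 2 * hnormV2 σ V * hnormV2 (σ + 1 / 2) V +
                 hnormV3 (σ + 3) b ^ 2 * hnormV2 σ V ^ 2 := by positivity
  rw [← ENNReal.ofReal_toReal (CT_ne_top hσ), ← ENNReal.ofReal_mul ENNReal.toReal_nonneg,
    ENNReal.ofReal_le_ofReal_iff (by positivity)] at h
  refine h.trans ?_
  gcongr
  linarith
end

/-- Let `σ > 3`. There is `C = C(σ) > 0` such that for every smooth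
divergence-free zero-mean vector field `b` on `𝕋³` and every smooth zero-mean ℝ²-valued
`V` with `𝒫V = V`, writing `B = b·∇` and `b^h = (b¹,b²)`,
`⟨(𝒫B)²V, Λ^{2σ}V⟩ + ‖Λ^σ 𝒫BV‖² ≤ C (‖b‖_{H^{σ+3}} ‖∂_z b^h‖_{H^{σ−3/2}} ‖V‖²_{H^{σ+1/2}}
 + ‖b‖²_{H^{σ+3}} ‖V‖_{H^σ} ‖V‖_{H^{σ+1/2}} + ‖b‖²_{H^{σ+3}} ‖V‖²_{H^σ})`. -/
theorem stmt5 (σ : ℝ) (hσ : 3 < σ) :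
    ∃ C : ℝ, 0 < C ∧
      ∀ b : Fin 3 → Z3 → ℂ, SmoothV3 b → DivFree b → (∀ j, ZeroMean (b j)) →
        ∀ V : Fin 2 → Z3 → ℂ, SmoothV2 V → (∀ i, ZeroMean (V i)) → hproj V = V →
          inner2V (PB b (PB b V)) (lamV (2 * σ) V) + (l2normV (lamV σ (PB b V))) ^ 2 ≤
            C * (hnormV3 (σ + 3) b * hnormV2 (σ - 3 / 2) (dzbh b) * hnormV2 (σ + 1 / 2) V ^ 2 +
                 hnormV3 (σ + 3) b ^ 2 * hnormV2 σ V * hnormV2 (σ + 1 / 2) V +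
                 hnormV3 (σ + 3) b ^ 2 * hnormV2 σ V ^ 2) := by
  exact main5 σ hσ
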